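/- Let M be a connected, non-compact surface. Then the singular homology groups H_j(M; ℤ) vanish for all j ≥ 2. -/

import Mathlib

open CategoryTheory

/-- The singular chain complex of a topological space `X` with integer coefficients:
the alternating face map complex of the free simplicial abelian group on the singular
simplicial set of `X`. -/
noncomputable def singularChainComplex (X : TopCat) : ChainComplex AddCommGrpCat ℕ :=
  (AlgebraicTopology.alternatingFaceMapComplex AddCommGrpCat).obj
    (((SimplicialObject.whiskering (Type) AddCommGrpCat).obj AddCommGrpCat.free).obj
      (TopCat.toSSet.obj X))

/-- The `n`-th singular homology group `H_n(X; ℤ)` of a topological space `X`. -/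
noncomputable def singularHomology (X : TopCat) (n : ℕ) : AddCommGrpCat :=
  (singularChainComplex X).homology n

namespace NCS

/-- The topological simplex. -/
abbrev Dl (n : ℕ) : Type := stdSimplex ℝ (Fin (n + 1))

/-- Families with face maps. -/
class HasFace (A : ℕ → Type) where
  face : ∀ {n : ℕ}, Fin (n + 2) → A (n + 1) → A n

/-- Chains on a family. -/
abbrev Ch (A : ℕ → Type) (n : ℕ) : Type := A n →₀ ℤ

/-- A generator. -/
noncomputable abbrev gen {A : ℕ → Type} {n : ℕ} (a : A n) : Ch A n := Finsupp.single a 1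

/-- linear extension -/
noncomputable abbrev lext {T : Type} {N : Type} [AddCommGroup N] (g : T → N) : (T →₀ ℤ) →ₗ[ℤ] N :=
  Finsupp.linearCombination ℤ g

theorem lext_single {T : Type} {N : Type} [AddCommGroup N] (g : T → N) (a : T) :
    lext g (Finsupp.single a 1) = g a := by simp

theorem lin_ext {T : Type} {N : Type} [AddCommGroup N] {f g : (T →₀ ℤ) →ₗ[ℤ] N}
    (h : ∀ a, f (Finsupp.single a 1) = g (Finsupp.single a 1)) : f = g := by
  apply Finsupp.lhom_ext'
  intro a
  apply LinearMap.ext_ring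
  exact h a

theorem lin_ext' {T : Type} {N : Type} [AddCommGroup N] {f g : (T →₀ ℤ) →ₗ[ℤ] N}
    (h : ∀ a, f (Finsupp.single a 1) = g (Finsupp.single a 1)) (c : T →₀ ℤ) : f c = g c := by
  rw [lin_ext h]

/-- The boundary map. -/
noncomputable def bd {A : ℕ → Type} [HasFace A] {n : ℕ} : Ch A (n + 1) →ₗ[ℤ] Ch A n :=
  lext fun a => ∑ i : Fin (n + 2), (-1 : ℤ) ^ (i : ℕ) • gen (HasFace.face i a)

theorem bd_gen {A : ℕ → Type} [HasFace A] {n : ℕ} (a : A (n + 1)) :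
    bd (gen a) = ∑ i : Fin (n + 2), (-1 : ℤ) ^ (i : ℕ) • gen (HasFace.face i a) :=
  lext_single _ _

/-- The induced map on chains. -/
noncomputable def cmap {S T : Type} (f : S → T) : (S →₀ ℤ) →ₗ[ℤ] (T →₀ ℤ) :=
  lext fun a => Finsupp.single (f a) 1

theorem cmap_gen {S T : Type} (f : S → T) (a : S) :
    cmap f (Finsupp.single a 1) = Finsupp.single (f a) 1 := lext_single _ _

theorem cmap_cmap {S T R : Type} (f : S → T) (g : T → R) (c : S →₀ ℤ) :
    cmap g (cmap f c) = cmap (g ∘ f) c := by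
  have : (cmap g).comp (cmap f) = cmap (g ∘ f) := lin_ext fun a => by simp [cmap_gen]
  exact LinearMap.congr_fun this c

theorem cmap_id {S : Type} (c : S →₀ ℤ) : cmap (id : S → S) c = c := by
  have : cmap (id : S → S) = LinearMap.id := lin_ext fun a => by simp [cmap_gen]
  exact LinearMap.congr_fun this c

theorem bd_cmap {A B : ℕ → Type} [HasFace A] [HasFace B] {n : ℕ} (f : A (n + 1) → B (n + 1))
    (g : A n → B n) (h : ∀ i a, HasFace.face i (f a) = g (HasFace.face i a)) (c : Ch A (n + 1)) :
    bd (cmap f c) = cmap g (bd c) := by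
  have : (bd (A := B)).comp (cmap f) = (cmap g).comp (bd (A := A)) := lin_ext fun a => by
    simp only [LinearMap.comp_apply, cmap_gen, bd_gen, map_sum, map_zsmul, h]
  exact LinearMap.congr_fun this c

/-! ### tuples -/

/-- Tuples of points. -/
abbrev Tup (Y : Type) (n : ℕ) : Type := Fin (n + 1) → Y

instance (Y : Type) : HasFace (Tup Y) where
  face i v := v ∘ i.succAbove

theorem face_tup {Y : Type} {n : ℕ} (i : Fin (n + 2)) (v : Tup Y (n + 1)) :
    HasFace.face i v = v ∘ i.succAbove := rfl

/-- coning -/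
noncomputable def cone {Y : Type} {n : ℕ} (b : Y) : Ch (Tup Y) n →ₗ[ℤ] Ch (Tup Y) (n + 1) :=
  cmap fun v => Fin.cons b v

theorem cone_gen {Y : Type} {n : ℕ} (b : Y) (v : Tup Y n) :
    cone b (gen v) = gen (A := Tup Y) (Fin.cons b v : Tup Y (n + 1)) := cmap_gen _ _

theorem bd_gen_cons {Y : Type} {n : ℕ} (b : Y) (v : Tup Y (n + 1)) :
    bd (gen (A := Tup Y) (Fin.cons b v : Tup Y (n + 2)))
      = gen v - cone b (bd (gen v)) := by
  rw [bd_gen, Fin.sum_univ_succ, bd_gen, map_sum, sub_eq_add_neg, ← Finset.sum_neg_distrib]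
  congr 1
  · simp only [Fin.val_zero, pow_zero, one_smul, face_tup]
    congr 1
  · refine Finset.sum_congr rfl fun i _ => ?_
    rw [map_zsmul, cone_gen, Fin.val_succ, pow_succ, mul_neg_one, neg_smul, face_tup, face_tup]
    congr 3
    funext j
    refine Fin.cases ?_ (fun j => ?_) j
    · simp
    · simp

theorem bd_cone {Y : Type} {n : ℕ} (b : Y) (c : Ch (Tup Y) (n + 1)) :
    bd (cone b c) = c - cone b (bd c) := by
  have : bd.comp (cone b) = LinearMap.id - (cone b).comp (bd (A := Tup Y) (n := n)) :=
    lin_ext fun a => by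
      simpa [cone_gen] using bd_gen_cons b a
  exact LinearMap.congr_fun this c

theorem bd_gen_cons_zero {Y : Type} (b : Y) (v : Tup Y 0) :
    bd (gen (A := Tup Y) (Fin.cons b v : Tup Y 1))
      = gen v - gen (A := Tup Y) (n := 0) (fun _ => b) := by
  rw [bd_gen, Fin.sum_univ_two, sub_eq_add_neg]
  simp only [Fin.val_zero, pow_zero, one_smul, Fin.val_one, pow_one, neg_smul]
  have h : HasFace.face (A := Tup Y) (n := 0) 1 (Fin.cons b v : Tup Y 1) = fun _ => b := by
    funext j
    fin_cases j
    rfl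
  rw [h]
  congr 2

theorem tup_cons {Y : Type} {n : ℕ} (v : Tup Y (n + 1)) :
    ∃ (b : Y) (w : Tup Y n), v = Fin.cons b w := ⟨v 0, Fin.tail v, (Fin.cons_self_tail v).symm⟩

theorem bd_bd_tup {Y : Type} {n : ℕ} (c : Ch (Tup Y) (n + 2)) : bd (bd c) = 0 := by
  induction n with
  | zero =>
    have : (bd (A := Tup Y) (n := 0)).comp (bd (A := Tup Y) (n := 1)) = 0 := lin_ext fun a => by
      obtain ⟨b, w, rfl⟩ := tup_cons a
      obtain ⟨x, u, rfl⟩ := tup_cons w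
      simp only [LinearMap.comp_apply, LinearMap.zero_apply]
      rw [bd_gen_cons, map_sub, bd_gen_cons_zero, map_sub, cone_gen, cone_gen, map_sub,
        bd_gen_cons_zero, bd_gen_cons_zero]
      abel
    exact LinearMap.congr_fun this c
  | succ n ih =>
    have : (bd (A := Tup Y) (n := n + 1)).comp (bd (A := Tup Y) (n := n + 2)) = 0 :=
      lin_ext fun a => by
        obtain ⟨b, w, rfl⟩ := tup_cons a
        simp only [LinearMap.comp_apply, LinearMap.zero_apply]
        rw [bd_gen_cons, map_sub, bd_cone, ih]
        simp
    exact LinearMap.congr_fun this c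

/-! ### convex spaces -/

/-- Spaces with convex combinations. -/
class Cvx (Y : Type) [TopologicalSpace Y] where
  comb : ∀ {k : ℕ}, Dl k → Tup Y k → Y
  cont : ∀ {k : ℕ} (v : Tup Y k), Continuous fun t => comb t v
  comb_map : ∀ {k l : ℕ} (f : Fin (k + 1) → Fin (l + 1)) (t : Dl k) (v : Tup Y l),
    comb (stdSimplex.map f t) v = comb t (v ∘ f)

open Cvx

theorem sum_map_smul {k l : ℕ} {E : Type} [AddCommGroup E] [Module ℝ E]
    (f : Fin (k + 1) → Fin (l + 1)) (t : Dl k) (v : Fin (l + 1) → E) :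
    ∑ i, (stdSimplex.map f t) i • v i = ∑ i, t i • v (f i) := by
  classical
  simp only [stdSimplex.map_coe, FunOnFinite.linearMap_apply_apply, Finset.sum_smul]
  rw [← Finset.sum_fiberwise (s := Finset.univ) (g := f)]
  refine Finset.sum_congr rfl fun i _ => Finset.sum_congr ?_ fun j hj => ?_
  · ext; simp
  · simp only [Finset.mem_filter] at hj
    simp [hj.2]

noncomputable instance (p : ℕ) : Cvx (Dl p) where
  comb t v := ⟨∑ i, t i • (v i).1,
    (convex_stdSimplex ℝ _).sum_mem (fun i _ => stdSimplex.zero_le t i) (stdSimplex.sum_eq_one t)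
      (fun i _ => (v i).2)⟩
  cont v := by
    refine Continuous.subtype_mk ?_ _
    refine continuous_finsetSum _ fun i _ => ?_
    have h : Continuous fun t : Dl _ => t i := (continuous_apply i).comp continuous_subtype_val
    exact h.smul continuous_const
  comb_map f t v := by
    apply Subtype.ext
    exact sum_map_smul f t fun i => (v i).1

theorem comb_val {p k : ℕ} (t : Dl k) (v : Tup (Dl p) k) :
    (comb t v).1 = ∑ i, t i • (v i).1 := rfl

instance {Y Z : Type} [TopologicalSpace Y] [TopologicalSpace Z] [Cvx Y] [Cvx Z] :
    Cvx (Y × Z) where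
  comb t v := (comb t fun i => (v i).1, comb t fun i => (v i).2)
  cont v := (cont _).prodMk (cont _)
  comb_map f t v := by
    rw [comb_map, comb_map]; rfl

/-- Affine maps -/
def IsAff {Y Z : Type} [TopologicalSpace Y] [TopologicalSpace Z] [Cvx Y] [Cvx Z] (f : Y → Z) :
    Prop := ∀ (k : ℕ) (t : Dl k) (v : Tup Y k), f (comb t v) = comb t (f ∘ v)

theorem isAff_comb {p q : ℕ} (v : Tup (Dl q) p) : IsAff (fun t : Dl p => comb t v) := by
  intro k t w
  apply Subtype.ext
  rw [comb_val, comb_val]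
  have h : ∀ i, (comb t w : Dl p) i = ∑ j, t j * (w j) i := fun i => by
    have := congrFun (comb_val t w) i
    rw [Finset.sum_apply] at this
    exact this
  simp only [h, Function.comp_apply, comb_val, Finset.sum_smul, Finset.smul_sum, mul_smul]
  exact Finset.sum_comm

/-- vertices of the simplex -/
noncomputable def vtx (p : ℕ) : Tup (Dl p) p := fun i => stdSimplex.vertex i

theorem comb_vtx {p : ℕ} (t : Dl p) : comb t (vtx p) = t := by
  apply Subtype.ext
  rw [comb_val]
  funext j
  simp only [vtx, Finset.sum_apply, Pi.smul_apply, smul_eq_mul]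
  simp [Pi.single_apply]
  rfl

/-- evaluation of an affine map at a vertex -/
theorem comb_at_vtx {p q : ℕ} (v : Tup (Dl q) p) (i : Fin (p + 1)) : comb (vtx p i) v = v i := by
  apply Subtype.ext
  rw [comb_val]
  rw [Finset.sum_eq_single i]
  · simp [vtx]
  · intro j _ hj
    simp [vtx, hj]
  · simp

/-- The map of tuples. -/
noncomputable def tmap {Y Z : Type} {n : ℕ} (f : Y → Z) : Ch (Tup Y) n →ₗ[ℤ] Ch (Tup Z) n :=
  cmap fun v => f ∘ v

theorem tmap_gen {Y Z : Type} {n : ℕ} (f : Y → Z) (v : Tup Y n) :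
    tmap f (gen v) = gen (A := Tup Z) (n := n) (f ∘ v) := cmap_gen _ _

theorem bd_tmap {Y Z : Type} {n : ℕ} (f : Y → Z) (c : Ch (Tup Y) (n + 1)) :
    bd (tmap f c) = tmap f (bd c) :=
  bd_cmap _ _ (fun _ _ => rfl) c

theorem tmap_cone {Y Z : Type} {n : ℕ} (f : Y → Z) (b : Y) (c : Ch (Tup Y) n) :
    tmap f (cone b c) = cone (f b) (tmap f c) := by
  rw [tmap, tmap, cone, cone, cmap_cmap, cmap_cmap]
  congr 2
  funext v
  exact Fin.comp_cons _ _ _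

/-- barycentre -/
noncomputable def bary {Y : Type} [TopologicalSpace Y] [Cvx Y] {n : ℕ} (v : Tup Y n) : Y :=
  comb (stdSimplex.barycenter : Dl n) v

theorem IsAff.bary {Y Z : Type} [TopologicalSpace Y] [TopologicalSpace Z] [Cvx Y] [Cvx Z]
    {f : Y → Z} (hf : IsAff f) {n : ℕ} (v : Tup Y n) : f (bary v) = NCS.bary (f ∘ v) := hf _ _ _

/-- subdivision of tuples -/
noncomputable def subd {Y : Type} [TopologicalSpace Y] [Cvx Y] :
    ∀ n : ℕ, Ch (Tup Y) n →ₗ[ℤ] Ch (Tup Y) n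
  | 0 => LinearMap.id
  | n + 1 => lext fun v => cone (bary v) (subd n (bd (gen v)))

/-- the homotopy for the subdivision of tuples -/
noncomputable def hmt {Y : Type} [TopologicalSpace Y] [Cvx Y] :
    ∀ n : ℕ, Ch (Tup Y) n →ₗ[ℤ] Ch (Tup Y) (n + 1)
  | 0 => 0
  | n + 1 => lext fun v => cone (bary v) (gen v - hmt n (bd (gen v)))

section
variable {Y Z : Type} [TopologicalSpace Y] [TopologicalSpace Z] [Cvx Y] [Cvx Z]

theorem subd_gen {n : ℕ} (v : Tup Y (n + 1)) :
    subd (n + 1) (gen v) = cone (bary v) (subd n (bd (gen v))) := lext_single _ _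

theorem hmt_gen {n : ℕ} (v : Tup Y (n + 1)) :
    hmt (n + 1) (gen v) = cone (bary v) (gen v - hmt n (bd (gen v))) := lext_single _ _

theorem hmt_zero (c : Ch (Tup Y) 0) : bd (hmt 0 c) = c - subd 0 c := by
  simp [hmt, subd]

theorem hmt_succ (n : ℕ) (c : Ch (Tup Y) (n + 1)) :
    bd (hmt (n + 1) c) = c - subd (n + 1) c - hmt n (bd c) := by
  have key : ∀ n : ℕ, (∀ c : Ch (Tup Y) (n + 1), bd (hmt n (bd c)) = bd c - subd n (bd c)) →
      ∀ c : Ch (Tup Y) (n + 1), bd (hmt (n + 1) c) = c - subd (n + 1) c - hmt n (bd c) := by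
    intro n h c
    have : bd.comp (hmt (Y := Y) (n + 1)) =
        LinearMap.id - subd (n + 1) - (hmt n).comp bd := lin_ext fun v => by
      simp only [LinearMap.comp_apply, LinearMap.sub_apply, LinearMap.id_apply]
      rw [hmt_gen, bd_cone, map_sub, h, subd_gen, sub_sub_cancel]
      abel
    exact LinearMap.congr_fun this c
  induction n with
  | zero => exact key 0 (fun c => hmt_zero _) c
  | succ n ih =>
    refine key (n + 1) (fun c => ?_) c
    rw [ih, bd_bd_tup, map_zero, sub_zero]

theorem subd_tmap {f : Y → Z} (hf : IsAff f) (n : ℕ) (c : Ch (Tup Y) n) :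
    subd n (tmap f c) = tmap f (subd n c) := by
  induction n with
  | zero => rfl
  | succ n ih =>
    have : (subd (n + 1)).comp (tmap f) = (tmap f).comp (subd (n + 1)) := lin_ext fun v => by
      simp only [LinearMap.comp_apply]
      rw [subd_gen, tmap_cone, tmap_gen, subd_gen, ← tmap_gen, bd_tmap, ih, hf.bary]
    exact LinearMap.congr_fun this c

theorem hmt_tmap {f : Y → Z} (hf : IsAff f) (n : ℕ) (c : Ch (Tup Y) n) :
    hmt n (tmap f c) = tmap f (hmt n c) := by
  induction n with
  | zero => simp [hmt]
  | succ n ih =>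
    have : (hmt (n + 1)).comp (tmap f) = (tmap f).comp (hmt (n + 1)) := lin_ext fun v => by
      simp only [LinearMap.comp_apply]
      rw [hmt_gen, tmap_cone, tmap_gen, hmt_gen, ← tmap_gen, bd_tmap, ih, hf.bary, map_sub (tmap f)]
    exact LinearMap.congr_fun this c

/-- inclusion of an end of the prism -/
def endp (e : Fin 2) (y : Y) : Y × Dl 1 := (y, stdSimplex.vertex e)

/-- prism operator on tuples -/
noncomputable def prism : ∀ n : ℕ, Ch (Tup Y) n →ₗ[ℤ] Ch (Tup (Y × Dl 1)) (n + 1)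
  | 0 => lext fun v => gen (A := Tup (Y × Dl 1)) (n := 1)
      (Fin.cons (endp 0 (v 0)) (endp 1 ∘ v : Tup (Y × Dl 1) 0))
  | n + 1 => lext fun v => cone (endp 0 (bary v))
      (tmap (endp 1) (gen v) - tmap (endp 0) (gen v) - prism n (bd (gen v)))

theorem prism_gen {n : ℕ} (v : Tup Y (n + 1)) :
    prism (n + 1) (gen v) = cone (endp 0 (bary v))
      (tmap (endp 1) (gen v) - tmap (endp 0) (gen v) - prism n (bd (gen v))) := lext_single _ _

theorem prism_zero_gen (v : Tup Y 0) :
    prism 0 (gen v) = gen (A := Tup (Y × Dl 1)) (n := 1)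
      (Fin.cons (endp 0 (v 0)) (endp 1 ∘ v : Tup (Y × Dl 1) 0)) := lext_single _ _

theorem bd_prism_zero (c : Ch (Tup Y) 0) :
    bd (prism 0 c) = tmap (endp 1) c - tmap (endp 0) c := by
  have : bd.comp (prism (Y := Y) 0) = tmap (endp 1) - tmap (endp 0) := lin_ext fun v => by
    simp only [LinearMap.comp_apply, LinearMap.sub_apply]
    rw [prism_zero_gen, bd_gen_cons_zero, tmap_gen, tmap_gen]
    congr 2
    funext j
    fin_cases j
    rfl
  exact LinearMap.congr_fun this c

theorem bd_prism_succ (n : ℕ) (c : Ch (Tup Y) (n + 1)) :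
    bd (prism (n + 1) c) = tmap (endp 1) c - tmap (endp 0) c - prism n (bd c) := by
  have key : ∀ n : ℕ, (∀ c : Ch (Tup Y) (n + 1), bd (prism n (bd c)) =
      tmap (endp 1) (bd c) - tmap (endp 0) (bd c)) →
      ∀ c : Ch (Tup Y) (n + 1),
        bd (prism (n + 1) c) = tmap (endp 1) c - tmap (endp 0) c - prism n (bd c) := by
    intro n h c
    have : bd.comp (prism (Y := Y) (n + 1)) =
        tmap (endp 1) - tmap (endp 0) - (prism n).comp bd := lin_ext fun v => by
      simp only [LinearMap.comp_apply, LinearMap.sub_apply]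
      rw [prism_gen, bd_cone, map_sub bd, map_sub bd, h, bd_tmap, bd_tmap, sub_self, map_zero, sub_zero]
    exact LinearMap.congr_fun this c
  induction n with
  | zero => exact key 0 (fun c => bd_prism_zero _) c
  | succ n ih =>
    refine key (n + 1) (fun c => ?_) c
    rw [ih, bd_bd_tup, map_zero, sub_zero]

theorem tmap_tmap {X Y Z : Type} {n : ℕ} (f : X → Y) (g : Y → Z) (c : Ch (Tup X) n) :
    tmap g (tmap f c) = tmap (g ∘ f) c := by
  rw [tmap, tmap, tmap, cmap_cmap]; rfl

theorem prism_tmap {f : Y → Z} (hf : IsAff f) (n : ℕ) (c : Ch (Tup Y) n) :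
    prism n (tmap f c) = tmap (Prod.map f id) (prism n c) := by
  have he : ∀ e, endp e ∘ f = Prod.map f (id : Dl 1 → Dl 1) ∘ endp e := fun e => rfl
  induction n with
  | zero =>
    have : (prism 0).comp (tmap f) = (tmap (Prod.map f id)).comp (prism 0) := lin_ext fun v => by
      simp only [LinearMap.comp_apply]
      rw [prism_zero_gen, tmap_gen, prism_zero_gen, tmap_gen]
      congr 1
      rw [Fin.comp_cons]; rfl
    exact LinearMap.congr_fun this c
  | succ n ih =>
    have : (prism (n + 1)).comp (tmap f) = (tmap (Prod.map f id)).comp (prism (n + 1)) :=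
      lin_ext fun v => by
        simp only [LinearMap.comp_apply]
        rw [prism_gen, tmap_cone, tmap_gen, prism_gen, map_sub (tmap _), map_sub (tmap _), ← tmap_gen, bd_tmap, ih,
          tmap_tmap, tmap_tmap, tmap_tmap, tmap_tmap, he, he, ← hf.bary]
        rfl
    exact LinearMap.congr_fun this c

end

end NCS

namespace NCS
open Cvx

/-! ### singular chains -/

/-- singular simplices -/
abbrev Sg (X : Type) [TopologicalSpace X] (n : ℕ) : Type := C(Dl n, X)

/-- coface map -/
noncomputable def dmap {n : ℕ} (i : Fin (n + 2)) : C(Dl n, Dl (n + 1)) :=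
  ⟨stdSimplex.map i.succAbove, stdSimplex.continuous_map _⟩

noncomputable instance (X : Type) [TopologicalSpace X] : HasFace (Sg X) where
  face i σ := σ.comp (dmap i)

section
variable {X Y Z : Type} [TopologicalSpace X] [TopologicalSpace Y] [TopologicalSpace Z]

theorem face_sg {n : ℕ} (i : Fin (n + 2)) (σ : Sg X (n + 1)) :
    HasFace.face i σ = σ.comp (dmap i) := rfl

/-- pushforward of chains -/
noncomputable def push {n : ℕ} (f : C(X, Y)) : Ch (Sg X) n →ₗ[ℤ] Ch (Sg Y) n :=
  cmap fun σ => f.comp σ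

theorem push_gen {n : ℕ} (f : C(X, Y)) (σ : Sg X n) :
    push f (gen σ) = gen (A := Sg Y) (n := n) (f.comp σ) := cmap_gen _ _

theorem push_push {n : ℕ} (f : C(X, Y)) (g : C(Y, Z)) (c : Ch (Sg X) n) :
    push g (push f c) = push (g.comp f) c := by
  rw [push, push, push, cmap_cmap]; rfl

theorem push_id {n : ℕ} (c : Ch (Sg X) n) : push (ContinuousMap.id X) c = c := by
  rw [push]; exact cmap_id c

theorem bd_push {n : ℕ} (f : C(X, Y)) (c : Ch (Sg X) (n + 1)) :
    bd (push f c) = push f (bd c) :=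
  bd_cmap _ _ (fun _ _ => rfl) c

/-- affine simplex -/
def aff [Cvx Y] {n : ℕ} (v : Tup Y n) : Sg Y n := ⟨fun t => comb t v, cont v⟩

/-- chains of affine simplices -/
noncomputable def affc [Cvx Y] {n : ℕ} : Ch (Tup Y) n →ₗ[ℤ] Ch (Sg Y) n := cmap aff

theorem affc_gen [Cvx Y] {n : ℕ} (v : Tup Y n) : affc (gen v) = gen (aff v) := cmap_gen _ _

theorem bd_affc [Cvx Y] {n : ℕ} (c : Ch (Tup Y) (n + 1)) : bd (affc c) = affc (bd c) :=
  bd_cmap _ _ (fun _ _ => ContinuousMap.ext fun _ => comb_map _ _ _) c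

theorem push_affc [Cvx Y] [Cvx Z] {n : ℕ} (f : C(Y, Z)) (hf : IsAff f) (c : Ch (Tup Y) n) :
    push f (affc c) = affc (tmap f c) := by
  rw [push, affc, affc, tmap, cmap_cmap, cmap_cmap]
  congr 2
  funext v
  exact ContinuousMap.ext fun t => hf _ _ _

theorem aff_vtx (n : ℕ) : aff (vtx n) = ContinuousMap.id (Dl n) :=
  ContinuousMap.ext fun t => comb_vtx t

theorem push_vtx {n : ℕ} (σ : Sg X n) : push σ (affc (gen (vtx n))) = gen σ := by
  rw [affc_gen, aff_vtx, push_gen]; rfl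

theorem bd_gen_sg {n : ℕ} (σ : Sg X (n + 1)) :
    bd (gen σ) = push σ (affc (bd (gen (vtx (n + 1))))) := by
  rw [← bd_affc, ← bd_push, push_vtx]

theorem bd_bd {n : ℕ} (c : Ch (Sg X) (n + 2)) : bd (bd c) = 0 := by
  have : (bd (A := Sg X) (n := n)).comp (bd (A := Sg X) (n := n + 1)) = 0 := lin_ext fun σ => by
    simp only [LinearMap.comp_apply, LinearMap.zero_apply]
    rw [bd_gen_sg, bd_push, bd_affc, bd_bd_tup, map_zero, map_zero]
  exact LinearMap.congr_fun this c

theorem tmap_aff_vtx {n p : ℕ} (v : Tup (Dl p) n) : tmap (aff v) (gen (vtx n)) = gen v := by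
  rw [tmap_gen]
  congr 1
  funext i
  exact comb_at_vtx v i

theorem isAff_aff {n p : ℕ} (v : Tup (Dl p) n) : IsAff (aff v) := isAff_comb v

/-- subdivision -/
noncomputable def Sd (n : ℕ) : Ch (Sg X) n →ₗ[ℤ] Ch (Sg X) n :=
  lext fun σ => push σ (affc (subd n (gen (vtx n))))

/-- homotopy from subdivision to the identity -/
noncomputable def Td (n : ℕ) : Ch (Sg X) n →ₗ[ℤ] Ch (Sg X) (n + 1) :=
  lext fun σ => push σ (affc (hmt n (gen (vtx n))))

/-- homotopy operator -/
noncomputable def Hp (F : C(X × Dl 1, Y)) (n : ℕ) : Ch (Sg X) n →ₗ[ℤ] Ch (Sg Y) (n + 1) :=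
  lext fun σ => push (F.comp (σ.prodMap (ContinuousMap.id _))) (affc (prism n (gen (vtx n))))

theorem Sd_gen {n : ℕ} (σ : Sg X n) :
    Sd n (gen σ) = push σ (affc (subd n (gen (vtx n)))) := lext_single _ _

theorem Td_gen {n : ℕ} (σ : Sg X n) :
    Td n (gen σ) = push σ (affc (hmt n (gen (vtx n)))) := lext_single _ _

theorem Hp_gen (F : C(X × Dl 1, Y)) {n : ℕ} (σ : Sg X n) :
    Hp F n (gen σ) = push (F.comp (σ.prodMap (ContinuousMap.id _)))
      (affc (prism n (gen (vtx n)))) := lext_single _ _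

theorem Sd_push_affc {n p : ℕ} (σ : Sg X p) (c : Ch (Tup (Dl p)) n) :
    Sd n (push σ (affc c)) = push σ (affc (subd n c)) := by
  have : (Sd n).comp ((push σ).comp affc) = (push σ).comp (affc.comp (subd n)) :=
    lin_ext fun v => by
      simp only [LinearMap.comp_apply]
      rw [affc_gen, push_gen, Sd_gen, ← push_push, push_affc _ (isAff_aff v),
        ← subd_tmap (isAff_aff v), tmap_aff_vtx]
  exact LinearMap.congr_fun this c

theorem Td_push_affc {n p : ℕ} (σ : Sg X p) (c : Ch (Tup (Dl p)) n) :
    Td n (push σ (affc c)) = push σ (affc (hmt n c)) := by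
  have : (Td n).comp ((push σ).comp affc) = (push σ).comp (affc.comp (hmt n)) :=
    lin_ext fun v => by
      simp only [LinearMap.comp_apply]
      rw [affc_gen, push_gen, Td_gen, ← push_push, push_affc _ (isAff_aff v),
        ← hmt_tmap (isAff_aff v), tmap_aff_vtx]
  exact LinearMap.congr_fun this c

theorem IsAff.prodMap [Cvx Y] [Cvx Z] {f : C(Y, Z)} (hf : IsAff f) :
    IsAff (f.prodMap (ContinuousMap.id (Dl 1))) := by
  intro k t v
  exact Prod.ext (hf _ _ _) rfl

theorem Hp_push_affc (F : C(X × Dl 1, Y)) {n p : ℕ} (σ : Sg X p) (c : Ch (Tup (Dl p)) n) :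
    Hp F n (push σ (affc c)) =
      push (F.comp (σ.prodMap (ContinuousMap.id _))) (affc (prism n c)) := by
  have : (Hp F n).comp ((push σ).comp affc) =
      (push (F.comp (σ.prodMap (ContinuousMap.id _)))).comp (affc.comp (prism n)) :=
    lin_ext fun v => by
      simp only [LinearMap.comp_apply]
      have h1 : F.comp (ContinuousMap.prodMap (σ.comp (aff v)) (ContinuousMap.id (Dl 1))) =
        (F.comp (σ.prodMap (ContinuousMap.id _))).comp
          ((aff v).prodMap (ContinuousMap.id (Dl 1))) := rfl
      rw [affc_gen, push_gen, Hp_gen, h1, ← push_push, push_affc _ (isAff_aff v).prodMap]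
      have h2 := prism_tmap (isAff_aff v) n (gen (vtx n))
      rw [tmap_aff_vtx] at h2
      rw [h2]
      rfl
  exact LinearMap.congr_fun this c

theorem bd_Td {n : ℕ} (c : Ch (Sg X) (n + 1)) :
    bd (Td (n + 1) c) = c - Sd (n + 1) c - Td n (bd c) := by
  have : bd.comp (Td (X := X) (n + 1)) = LinearMap.id - Sd (n + 1) - (Td n).comp bd :=
    lin_ext fun σ => by
      simp only [LinearMap.comp_apply, LinearMap.sub_apply, LinearMap.id_apply]
      rw [Td_gen, bd_push, bd_affc, hmt_succ, Sd_gen, bd_gen_sg, Td_push_affc]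
      simp only [map_sub]
      rw [push_vtx]
  exact LinearMap.congr_fun this c

theorem bd_Td_zero (c : Ch (Sg X) 0) : bd (Td 0 c) = c - Sd 0 c := by
  have : bd.comp (Td (X := X) 0) = LinearMap.id - Sd 0 :=
    lin_ext fun σ => by
      simp only [LinearMap.comp_apply, LinearMap.sub_apply, LinearMap.id_apply]
      rw [Td_gen, bd_push, bd_affc, hmt_zero, Sd_gen]
      simp only [map_sub]
      rw [push_vtx]
  exact LinearMap.congr_fun this c

theorem bd_Sd {n : ℕ} (c : Ch (Sg X) (n + 1)) : bd (Sd (n + 1) c) = Sd n (bd c) := by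
  have h := bd_Td c
  have h2 : Sd (n + 1) c = c - Td n (bd c) - bd (Td (n + 1) c) := by rw [h]; abel
  rw [h2, map_sub, map_sub, bd_bd, sub_zero]
  cases n with
  | zero => rw [bd_Td_zero]; abel
  | succ n => rw [bd_Td, bd_bd, map_zero]; abel

theorem isAff_endp {p : ℕ} (e : Fin 2) : IsAff (endp (Y := Dl p) e) := by
  intro k t v
  refine Prod.ext rfl ?_
  apply Subtype.ext
  change _ = ∑ i, t i • (stdSimplex.vertex e : Dl 1).1
  rw [← Finset.sum_smul, stdSimplex.sum_eq_one, one_smul]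
  rfl

/-- an end of a homotopy -/
def fend (F : C(X × Dl 1, Y)) (e : Fin 2) : C(X, Y) :=
  ⟨fun x => F (x, stdSimplex.vertex e), by fun_prop⟩

theorem push_endp (F : C(X × Dl 1, Y)) {n : ℕ} (σ : Sg X n) (e : Fin 2) :
    push (F.comp (σ.prodMap (ContinuousMap.id _))) (affc (tmap (endp e) (gen (vtx n)))) =
      push (fend F e) (gen σ) := by
  have := push_affc (⟨endp e, by unfold endp; fun_prop⟩ : C(Dl n, Dl n × Dl 1)) (isAff_endp e)
    (gen (vtx n))
  rw [ContinuousMap.coe_mk] at this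
  rw [← this, affc_gen, aff_vtx, push_push, push_gen, push_gen]
  rfl

theorem bd_Hp (F : C(X × Dl 1, Y)) {n : ℕ} (c : Ch (Sg X) (n + 1)) :
    bd (Hp F (n + 1) c) = push (fend F 1) c - push (fend F 0) c - Hp F n (bd c) := by
  have : bd.comp (Hp F (n + 1)) = push (fend F 1) - push (fend F 0) - (Hp F n).comp bd :=
    lin_ext fun σ => by
      simp only [LinearMap.comp_apply, LinearMap.sub_apply]
      rw [Hp_gen, bd_push, bd_affc, bd_prism_succ, bd_gen_sg, Hp_push_affc]
      simp only [map_sub]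
      rw [push_endp, push_endp]
  exact LinearMap.congr_fun this c

/-! ### supports -/

/-- chains carried by a subset -/
def SS (W : Set X) (n : ℕ) : Submodule ℤ (Ch (Sg X) n) :=
  Finsupp.supported ℤ ℤ {σ : Sg X n | ∀ t, σ t ∈ W}

theorem supp_map {T N : Type} [AddCommGroup N] {s : Set T} {p : Submodule ℤ N}
    (L : (T →₀ ℤ) →ₗ[ℤ] N) (h : ∀ a ∈ s, L (Finsupp.single a 1) ∈ p) {c : T →₀ ℤ}
    (hc : c ∈ Finsupp.supported ℤ ℤ s) : L c ∈ p := by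
  rw [Finsupp.supported_eq_span_single] at hc
  have : Submodule.span ℤ ((fun i => Finsupp.single i (1 : ℤ)) '' s) ≤ p.comap L := by
    rw [Submodule.span_le]
    rintro _ ⟨a, ha, rfl⟩
    exact h a ha
  exact this hc

theorem SS_map {N : Type} [AddCommGroup N] {W : Set X} {n : ℕ} {p : Submodule ℤ N}
    (L : Ch (Sg X) n →ₗ[ℤ] N) (h : ∀ σ : Sg X n, (∀ t, σ t ∈ W) → L (gen σ) ∈ p)
    {c : Ch (Sg X) n} (hc : c ∈ SS W n) : L c ∈ p := supp_map L h hc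

theorem gen_mem_SS {W : Set X} {n : ℕ} {σ : Sg X n} (h : ∀ t, σ t ∈ W) : gen σ ∈ SS W n :=
  Finsupp.single_mem_supported _ _ h

theorem SS_mono {U V : Set X} (h : U ⊆ V) {n : ℕ} : SS U n ≤ SS V n :=
  Finsupp.supported_mono fun _ hσ t => h (hσ t)

theorem SS_univ {n : ℕ} (c : Ch (Sg X) n) : c ∈ SS (Set.univ : Set X) n := by
  rw [SS, Finsupp.mem_supported]
  intro σ _ t
  trivial

theorem SS_inter {U V : Set X} {n : ℕ} {c : Ch (Sg X) n} (hU : c ∈ SS U n) (hV : c ∈ SS V n) :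
    c ∈ SS (U ∩ V) n := by
  rw [SS, Finsupp.mem_supported] at *
  exact fun σ hσ t => ⟨hU hσ t, hV hσ t⟩

theorem SS_empty {n : ℕ} {c : Ch (Sg X) n} (h : c ∈ SS (∅ : Set X) n) : c = 0 := by
  rw [SS, Finsupp.mem_supported] at h
  rw [← Finsupp.support_eq_empty, Finset.eq_empty_iff_forall_notMem]
  intro σ hσ
  exact h hσ (Classical.arbitrary _)

theorem push_mem_SS {n : ℕ} (f : C(X, Y)) {W : Set Y} {V : Set X} (h : ∀ x ∈ V, f x ∈ W)
    {c : Ch (Sg X) n} (hc : c ∈ SS V n) : push f c ∈ SS W n :=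
  SS_map _ (fun σ hσ => by rw [push_gen]; exact gen_mem_SS fun t => h _ (hσ t)) hc

theorem push_mem_SS' {n : ℕ} (f : C(X, Y)) {W : Set Y} (h : ∀ x, f x ∈ W)
    (c : Ch (Sg X) n) : push f c ∈ SS W n :=
  push_mem_SS f (V := Set.univ) (fun x _ => h x) (SS_univ c)

theorem bd_mem_SS {n : ℕ} {W : Set X} {c : Ch (Sg X) (n + 1)} (hc : c ∈ SS W (n + 1)) :
    bd c ∈ SS W n :=
  SS_map _ (fun σ hσ => by rw [bd_gen_sg]; exact push_mem_SS' _ hσ _) hc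

theorem Sd_mem_SS {n : ℕ} {W : Set X} {c : Ch (Sg X) n} (hc : c ∈ SS W n) :
    Sd n c ∈ SS W n :=
  SS_map _ (fun σ hσ => by rw [Sd_gen]; exact push_mem_SS' _ hσ _) hc

theorem Td_mem_SS {n : ℕ} {W : Set X} {c : Ch (Sg X) n} (hc : c ∈ SS W n) :
    Td n c ∈ SS W (n + 1) :=
  SS_map _ (fun σ hσ => by rw [Td_gen]; exact push_mem_SS' _ hσ _) hc

/-- chains carried by a subset come from the subspace -/
theorem exists_push_val {n : ℕ} {W : Set X} {c : Ch (Sg X) n} (hc : c ∈ SS W n) :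
    ∃ c' : Ch (Sg W) n, push ⟨Subtype.val, continuous_subtype_val⟩ c' = c := by
  have : (LinearMap.id : Ch (Sg X) n →ₗ[ℤ] Ch (Sg X) n) c ∈ LinearMap.range
      (push (n := n) (⟨Subtype.val, continuous_subtype_val⟩ : C(W, X))) := by
    refine SS_map _ (fun σ hσ => ?_) hc
    refine ⟨gen (A := Sg W) (n := n) ⟨fun t => ⟨σ t, hσ t⟩, by fun_prop⟩, ?_⟩
    rw [push_gen]
    rfl
  exact this

theorem push_injective {n : ℕ} {f : C(X, Y)} (hf : Function.Injective f) :
    Function.Injective (push (n := n) f) := by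
  have : ⇑(push (n := n) f) = Finsupp.mapDomain fun σ : Sg X n => f.comp σ := by
    funext c
    have : push f = Finsupp.lmapDomain ℤ ℤ fun σ : Sg X n => f.comp σ := lin_ext fun σ => by
      simp [push_gen]
    rw [this]; rfl
  rw [this]
  refine Finsupp.mapDomain_injective fun σ τ h => ContinuousMap.ext fun t => hf ?_
  exact DFunLike.congr_fun h t

/-- the image of a chain -/
def img {n : ℕ} (c : Ch (Sg X) n) : Set X := ⋃ σ ∈ c.support, Set.range σ

theorem isCompact_img {n : ℕ} (c : Ch (Sg X) n) : IsCompact (img c) := by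
  refine c.support.isCompact_biUnion fun σ _ => ?_
  have : CompactSpace (Dl n) := isCompact_iff_compactSpace.mp (isCompact_stdSimplex ℝ _)
  exact isCompact_range σ.continuous

theorem mem_SS_iff {n : ℕ} {W : Set X} {c : Ch (Sg X) n} : c ∈ SS W n ↔ img c ⊆ W := by
  rw [SS, Finsupp.mem_supported, img]
  simp only [Set.iUnion_subset_iff]
  constructor
  · rintro h σ hσ _ ⟨t, rfl⟩
    exact h hσ t
  · intro h σ hσ t
    exact h σ hσ ⟨t, rfl⟩

end
end NCS

namespace NCS
open Cvx

/-! ### mesh -/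

/-- tuples of small diameter -/
def Fine {p n : ℕ} (r : ℝ) (v : Tup (Dl p) n) : Prop := ∀ i j, dist (v i) (v j) ≤ r

theorem dist_comb_le {p k : ℕ} (t : Dl k) (v : Tup (Dl p) k) (y : Dl p) (ρ : ℝ)
    (h : ∀ i, dist (v i) y ≤ ρ) : dist (comb t v) y ≤ ρ := by
  have := (convex_closedBall (y.1) ρ).sum_mem (t := Finset.univ) (w := fun i => t i)
    (z := fun i => (v i).1)
    (fun i _ => stdSimplex.zero_le t i) (stdSimplex.sum_eq_one t) (fun i _ => h i)
  exact this

theorem dist_bary_le {p n : ℕ} {r : ℝ} (v : Tup (Dl p) n) (h : Fine r v) (j : Fin (n + 1)) :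
    dist (v j) (bary v) ≤ n / (n + 1) * r := by
  have hb : (bary v).1 = ∑ i, ((n : ℝ) + 1)⁻¹ • (v i).1 := by
    rw [bary, comb_val]
    refine Finset.sum_congr rfl fun i _ => ?_
    congr 1
    have := stdSimplex.barycenter_apply (𝕜 := ℝ) i
    rw [Fintype.card_fin] at this
    push_cast at this
    exact this
  have hn : ((n : ℝ) + 1) ≠ 0 := by positivity
  have h1 : (v j).1 = ∑ i : Fin (n + 1), ((n : ℝ) + 1)⁻¹ • (v j).1 := by
    rw [Finset.sum_const, Finset.card_univ, Fintype.card_fin, ← Nat.cast_smul_eq_nsmul ℝ,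
      smul_smul]
    push_cast
    rw [mul_inv_cancel₀ hn, one_smul]
  rw [dist_comm, Subtype.dist_eq, dist_eq_norm, hb]
  rw [h1]
  rw [← Finset.sum_sub_distrib, ← Finset.add_sum_erase _ _ (Finset.mem_univ j), sub_self, zero_add]
  refine (norm_sum_le _ _).trans ?_
  have : ∀ i ∈ Finset.univ.erase j,
      ‖((n : ℝ) + 1)⁻¹ • (v i).1 - ((n : ℝ) + 1)⁻¹ • (v j).1‖ ≤ ((n : ℝ) + 1)⁻¹ * r := by
    intro i _
    rw [← smul_sub, norm_smul, Real.norm_of_nonneg (by positivity), ← dist_eq_norm]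
    exact mul_le_mul_of_nonneg_left (h i j) (by positivity)
  refine (Finset.sum_le_card_nsmul _ _ _ this).trans ?_
  rw [Finset.card_erase_of_mem (Finset.mem_univ j), Finset.card_univ, Fintype.card_fin,
    nsmul_eq_mul]
  apply le_of_eq
  push_cast [Nat.add_sub_cancel]
  field_simp

theorem subd_fine {p n : ℕ} {r : ℝ} (v : Tup (Dl p) n) (h : Fine r v) :
    subd n (gen v) ∈ Finsupp.supported ℤ ℤ {w : Tup (Dl p) n | Fine (n / (n + 1) * r) w ∧
      ∀ y ρ, (∀ i, dist (v i) y ≤ ρ) → ∀ j, dist (w j) y ≤ ρ} := by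
  induction n with
  | zero =>
    refine Finsupp.single_mem_supported _ _ ⟨fun i j => ?_, fun y ρ hy => hy⟩
    obtain rfl : i = j := Fin.ext (by omega)
    simp
  | succ n ih =>
    have hr : 0 ≤ r := dist_nonneg.trans (h 0 0)
    rw [subd_gen]
    have h1 : subd n (bd (gen v)) ∈ Finsupp.supported ℤ ℤ {w : Tup (Dl p) n |
        Fine (n / (n + 1) * r) w ∧
        ∀ y ρ, (∀ i, dist (v i) y ≤ ρ) → ∀ j, dist (w j) y ≤ ρ} := by
      rw [bd_gen, map_sum]
      refine Submodule.sum_mem _ fun i _ => ?_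
      rw [map_zsmul]
      refine Submodule.smul_mem _ _ ?_
      refine Finsupp.supported_mono ?_ (ih (HasFace.face i v) fun a b => h _ _)
      rintro w ⟨hw1, hw2⟩
      exact ⟨hw1, fun y ρ hy => hw2 y ρ fun a => hy _⟩
    refine supp_map _ ?_ h1
    rintro w ⟨hw1, hw2⟩
    have hle : (n : ℝ) / (n + 1) * r ≤ ((n + 1 : ℕ) : ℝ) / ((n + 1 : ℕ) + 1) * r := by
      refine mul_le_mul_of_nonneg_right ?_ hr
      rw [div_le_div_iff₀ (by positivity) (by positivity)]
      push_cast
      nlinarith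
    have hb : ∀ j, dist (w j) (bary v) ≤ ((n + 1 : ℕ) : ℝ) / ((n + 1 : ℕ) + 1) * r :=
      hw2 _ _ (dist_bary_le v h)
    have := cone_gen (bary v) w
    rw [this]
    refine Finsupp.single_mem_supported _ _ ⟨fun i j => ?_, fun y ρ hy j => ?_⟩
    · refine Fin.cases ?_ (fun i => ?_) i <;> refine Fin.cases ?_ (fun j => ?_) j
      · simp only [Fin.cons_zero, dist_self]; positivity
      · simp only [Fin.cons_zero, Fin.cons_succ]; rw [dist_comm]; exact hb j
      · simp only [Fin.cons_zero, Fin.cons_succ]; exact hb i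
      · simp only [Fin.cons_succ]; exact (hw1 i j).trans hle
    · refine Fin.cases ?_ (fun j => ?_) j
      · simp only [Fin.cons_zero]; exact dist_comb_le _ _ _ _ hy
      · simp only [Fin.cons_succ]; exact hw2 y ρ hy j

theorem subd_iter_fine {p n : ℕ} {r : ℝ} (v : Tup (Dl p) n) (h : Fine r v) (m : ℕ) :
    (subd n)^[m] (gen v) ∈ Finsupp.supported ℤ ℤ
      {w : Tup (Dl p) n | Fine (((n : ℝ) / (n + 1)) ^ m * r) w} := by
  induction m with
  | zero =>
    refine Finsupp.single_mem_supported _ _ ?_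
    simpa using h
  | succ m ih =>
    rw [Function.iterate_succ_apply']
    refine supp_map (subd n) (fun w hw => ?_) ih
    refine Finsupp.supported_mono ?_ (subd_fine w hw)
    rintro u ⟨hu, -⟩
    have : ((n : ℝ) / (n + 1)) ^ (m + 1) * r = n / (n + 1) * (((n : ℝ) / (n + 1)) ^ m * r) := by
      ring
    simpa only [Set.mem_setOf_eq, this] using hu

section
variable {X Y Z : Type} [TopologicalSpace X] [TopologicalSpace Y] [TopologicalSpace Z]

theorem Sd_iter_push {n p : ℕ} (σ : Sg X p) (c : Ch (Tup (Dl p)) n) (m : ℕ) :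
    (Sd n)^[m] (push σ (affc c)) = push σ (affc ((subd n)^[m] c)) := by
  induction m with
  | zero => rfl
  | succ m ih => rw [Function.iterate_succ_apply', ih, Sd_push_affc, Function.iterate_succ_apply']

theorem Sd_iter_gen {U V : Set X} (hU : IsOpen U) (hV : IsOpen V) {n : ℕ} (σ : Sg X n)
    (hσ : ∀ t, σ t ∈ U ∪ V) : ∃ m, ∀ m' ≥ m, (Sd n)^[m'] (gen σ) ∈ SS U n ⊔ SS V n := by
  have : CompactSpace (Dl n) := isCompact_iff_compactSpace.mp (isCompact_stdSimplex ℝ _)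
  obtain ⟨δ, hδ, H⟩ := lebesgue_number_lemma_of_metric (s := (Set.univ : Set (Dl n)))
    (c := fun b : Bool => if b then σ ⁻¹' U else σ ⁻¹' V) isCompact_univ (by
      rintro (_ | _)
      · exact hV.preimage σ.continuous
      · exact hU.preimage σ.continuous) (by
      intro t _
      rcases hσ t with h | h
      · exact Set.mem_iUnion.2 ⟨true, by simpa using h⟩
      · exact Set.mem_iUnion.2 ⟨false, by simpa using h⟩)
  have hv : Fine (Metric.diam (Set.univ : Set (Dl n))) (vtx n) := fun i j =>
    Metric.dist_le_diam_of_mem isCompact_univ.isBounded trivial trivial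
  have ht : Filter.Tendsto (fun m : ℕ => ((n : ℝ) / (n + 1)) ^ m *
      (Metric.diam (Set.univ : Set (Dl n)))) Filter.atTop (nhds 0) := by
    have := (tendsto_pow_atTop_nhds_zero_of_lt_one (r := (n : ℝ) / (n + 1)) (by positivity)
      (by rw [div_lt_one (by positivity)]; linarith)).mul_const
      (Metric.diam (Set.univ : Set (Dl n)))
    simpa using this
  obtain ⟨m, hm⟩ := Filter.eventually_atTop.1 (ht.eventually (gt_mem_nhds hδ))
  refine ⟨m, fun m' hm' => ?_⟩
  rw [← push_vtx σ, Sd_iter_push]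
  refine supp_map ((push σ).comp affc) (fun w hw => ?_) (subd_iter_fine (vtx n) hv m')
  simp only [LinearMap.comp_apply]
  have h3 := affc_gen w
  rw [h3, push_gen]
  obtain ⟨b, hb⟩ := H (w 0) trivial
  have h2 : ∀ t, aff w t ∈ Metric.ball (w 0) δ := fun t =>
    lt_of_le_of_lt (dist_comb_le t w (w 0) _ fun i => hw i 0) (hm m' hm')
  cases b with
  | true => exact Submodule.mem_sup_left (gen_mem_SS fun t => by simpa using hb (h2 t))
  | false => exact Submodule.mem_sup_right (gen_mem_SS fun t => by simpa using hb (h2 t))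

theorem Sd_mem_sup {U V : Set X} {n : ℕ} {c : Ch (Sg X) n} (hc : c ∈ SS U n ⊔ SS V n) :
    Sd n c ∈ SS U n ⊔ SS V n := by
  obtain ⟨a, ha, b, hb, rfl⟩ := Submodule.mem_sup.1 hc
  rw [map_add]
  exact Submodule.add_mem_sup (Sd_mem_SS ha) (Sd_mem_SS hb)

theorem Td_mem_sup {U V : Set X} {n : ℕ} {c : Ch (Sg X) n} (hc : c ∈ SS U n ⊔ SS V n) :
    Td n c ∈ SS U (n + 1) ⊔ SS V (n + 1) := by
  obtain ⟨a, ha, b, hb, rfl⟩ := Submodule.mem_sup.1 hc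
  rw [map_add]
  exact Submodule.add_mem_sup (Td_mem_SS ha) (Td_mem_SS hb)

theorem Sd_iter_exists {U V : Set X} (hU : IsOpen U) (hV : IsOpen V) {n : ℕ} {c : Ch (Sg X) n}
    (hc : c ∈ SS (U ∪ V) n) : ∃ m, (Sd n)^[m] c ∈ SS U n ⊔ SS V n := by
  let p : Submodule ℤ (Ch (Sg X) n) :=
    { carrier := {c | ∃ m, ∀ m' ≥ m, (Sd n)^[m'] c ∈ SS U n ⊔ SS V n}
      add_mem' := by
        rintro a b ⟨m, hm⟩ ⟨k, hk⟩
        refine ⟨max m k, fun m' hm' => ?_⟩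
        rw [iterate_map_add]
        exact Submodule.add_mem _ (hm _ (le_trans (le_max_left _ _) hm'))
          (hk _ (le_trans (le_max_right _ _) hm'))
      zero_mem' := ⟨0, fun m' _ => by rw [iterate_map_zero]; exact Submodule.zero_mem _⟩
      smul_mem' := by
        rintro z a ⟨m, hm⟩
        refine ⟨m, fun m' hm' => ?_⟩
        rw [iterate_map_zsmul]
        exact Submodule.smul_mem _ _ (hm _ hm') }
  have h : (LinearMap.id : Ch (Sg X) n →ₗ[ℤ] Ch (Sg X) n) c ∈ p :=
    SS_map _ (fun σ hσ => Sd_iter_gen hU hV σ hσ) hc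
  obtain ⟨m, hm⟩ := h
  exact ⟨m, hm m le_rfl⟩

/-- small simplices suffice -/
theorem small {U V : Set X} (hU : IsOpen U) (hV : IsOpen V) {n : ℕ} {c : Ch (Sg X) (n + 1)}
    (hc : c ∈ SS (U ∪ V) (n + 1)) (hb : bd c ∈ SS U n ⊔ SS V n) :
    ∃ a ∈ SS U (n + 1), ∃ b ∈ SS V (n + 1), ∃ d ∈ SS (U ∪ V) (n + 2), c = a + b + bd d := by
  obtain ⟨m, hm⟩ := Sd_iter_exists hU hV hc
  induction m generalizing c with
  | zero =>
    obtain ⟨a, ha, b, hb, h⟩ := Submodule.mem_sup.1 hm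
    exact ⟨a, ha, b, hb, 0, Submodule.zero_mem _, by rw [map_zero, add_zero, h]; rfl⟩
  | succ m ih =>
    obtain ⟨a, ha, b, hb', d, hd, h⟩ := ih (c := Sd (n + 1) c) (Sd_mem_SS hc)
      (by rw [bd_Sd]; exact Sd_mem_sup hb) (by rwa [← Function.iterate_succ_apply])
    obtain ⟨a', ha', b', hb'', h'⟩ := Submodule.mem_sup.1 (Td_mem_sup hb)
    refine ⟨a + a', Submodule.add_mem _ ha ha', b + b', Submodule.add_mem _ hb' hb'',
      d + Td (n + 1) c, Submodule.add_mem _ hd (Td_mem_SS hc), ?_⟩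
    rw [map_add, bd_Td, h, ← h']
    abel

/-! ### bounding cycles -/

/-- `e` bounds in `W` -/
def Bds {n : ℕ} (W : Set X) (e : Ch (Sg X) n) : Prop := ∃ f ∈ SS W (n + 1), bd f = e

/-- `k+1`-cycles bound in `W` -/
def Acyc (k : ℕ) (W : Set X) : Prop :=
  ∀ e ∈ SS W (k + 1), bd e = 0 → Bds W e

theorem Bds.push {n : ℕ} {W : Set X} {e : Ch (Sg X) n} (h : Bds W e) (f : C(X, Y)) {V : Set Y}
    (hf : ∀ x ∈ W, f x ∈ V) : Bds V (push f e) := by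
  obtain ⟨g, hg, rfl⟩ := h
  exact ⟨NCS.push f g, push_mem_SS f hf hg, bd_push f g⟩

theorem push_const {n : ℕ} (y : Y) : ∀ k : ℕ, ∀ c : Ch (Sg X) k,
    ∃ z : ℤ, push (ContinuousMap.const X y) c = z • gen (A := Sg Y) (n := k) (.const _ y) := by
  intro k c
  have : (LinearMap.id : Ch (Sg X) k →ₗ[ℤ] _) c ∈
      (Submodule.span ℤ {gen (A := Sg Y) (n := k) (.const _ y)}).comap
        (push (ContinuousMap.const X y)) := by
    refine SS_map (W := Set.univ) _ (fun σ _ => ?_) (SS_univ c)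
    refine Submodule.subset_span ?_
    rw [Set.mem_singleton_iff, LinearMap.id_apply, push_gen]
    rfl
  obtain ⟨z, hz⟩ := Submodule.mem_span_singleton.1 (Submodule.mem_comap.1 this)
  exact ⟨z, hz.symm⟩

theorem bd_const (y : Y) (k : ℕ) : bd (gen (A := Sg Y) (n := k + 1) (.const _ y)) =
    if Even (k + 1) then gen (A := Sg Y) (n := k) (.const _ y) else 0 := by
  rw [bd_gen]
  have h : ∀ i : Fin (k + 2), HasFace.face (A := Sg Y) i (.const (Dl (k + 1)) y) =
    ContinuousMap.const (Dl k) y := fun i => rfl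
  simp only [h]
  rw [← Finset.sum_smul, Fin.sum_univ_eq_sum_range (fun i => (-1 : ℤ) ^ i), Finset.sum_range,
    Fin.sum_neg_one_pow]
  rcases Nat.even_or_odd (k + 1) with h | h
  · have : ¬ Even (k + 2) := by rw [Nat.even_add_one]; simpa using h
    simp [h, this]
  · have h1 : ¬ Even (k + 1) := by simpa using h
    have : Even (k + 2) := by rw [Nat.even_add_one]; exact h1
    simp [h1, this]

theorem const_bounds (y : Y) {W : Set Y} (hy : y ∈ W) {k : ℕ} (c : Ch (Sg X) (k + 1))
    (hc : bd c = 0) : Bds W (push (ContinuousMap.const X y) c) := by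
  obtain ⟨z, hz⟩ := push_const (n := 0) y (k + 1) c
  rcases Nat.even_or_odd (k + 1) with h | h
  · have h1 : bd (push (ContinuousMap.const X y) c) = 0 := by rw [bd_push, hc, map_zero]
    rw [hz, map_zsmul, bd_const, if_pos h] at h1
    have : z = 0 := by simpa using h1
    rw [hz, this, zero_smul]
    exact ⟨0, Submodule.zero_mem _, map_zero _⟩
  · refine ⟨z • gen (A := Sg Y) (n := k + 2) (.const _ y), ?_, ?_⟩
    · exact Submodule.smul_mem _ _ (gen_mem_SS fun _ => hy)
    · rw [map_zsmul, bd_const, hz, if_pos]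
      rw [Nat.even_add_one]; simpa using h

theorem Hp_mem_SS (F : C(X × Dl 1, Y)) {W : Set Y} (hF : ∀ x, F x ∈ W) {k : ℕ}
    (c : Ch (Sg X) k) : Hp F k c ∈ SS W (k + 1) := by
  refine SS_map (W := Set.univ) (p := SS W (k + 1)) (Hp F k) (fun σ _ => ?_) (SS_univ c)
  rw [Hp_gen]
  exact push_mem_SS' (F.comp (σ.prodMap (ContinuousMap.id _))) (fun x => hF _) _

theorem homotopy_bounds (F : C(X × Dl 1, Y)) {W : Set Y} (hF : ∀ x, F x ∈ W) {k : ℕ}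
    (c : Ch (Sg X) (k + 1)) (hc : bd c = 0) (h1 : Bds W (push (fend F 1) c)) :
    Bds W (push (fend F 0) c) := by
  obtain ⟨g, hg, hg'⟩ := h1
  refine ⟨g - Hp F (k + 1) c, Submodule.sub_mem _ hg (Hp_mem_SS F hF c), ?_⟩
  · rw [map_sub bd, bd_Hp, hc, hg', map_zero]
    abel

end
end NCS

namespace NCS
open Cvx

section
variable {X Y : Type} [TopologicalSpace X] [TopologicalSpace Y]

theorem acyc_union {U V : Set X} (hU : IsOpen U) (hV : IsOpen V) {k : ℕ} (aU : Acyc (k + 1) U)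
    (aV : Acyc (k + 1) V) (aUV : Acyc k (U ∩ V)) : Acyc (k + 1) (U ∪ V) := by
  intro e he hbe
  obtain ⟨a, ha, b, hb, d, hd, h⟩ := small hU hV he (by rw [hbe]; exact Submodule.zero_mem _)
  have h1 : bd a = -bd b := by
    have := hbe
    rw [h, map_add, map_add, bd_bd, add_zero] at this
    exact eq_neg_of_add_eq_zero_left this
  have h2 : bd a ∈ SS (U ∩ V) (k + 1) := by
    refine SS_inter (bd_mem_SS ha) ?_
    rw [h1]
    exact Submodule.neg_mem _ (bd_mem_SS hb)
  obtain ⟨f, hf, hf'⟩ := aUV _ h2 (bd_bd a)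
  obtain ⟨p, hp, hp'⟩ := aU (a - f)
    (Submodule.sub_mem _ ha (SS_mono Set.inter_subset_left hf)) (by rw [map_sub bd, hf', sub_self])
  obtain ⟨q, hq, hq'⟩ := aV (b + f)
    (Submodule.add_mem _ hb (SS_mono Set.inter_subset_right hf))
    (by rw [map_add bd, hf', h1, add_neg_cancel])
  refine ⟨p + q + d, Submodule.add_mem _ (Submodule.add_mem _ (SS_mono Set.subset_union_left hp)
    (SS_mono Set.subset_union_right hq)) hd, ?_⟩
  rw [map_add bd, map_add bd, hp', hq', h]
  abel

theorem acyc_disj {U V : Set X} (hU : IsOpen U) (hV : IsOpen V) {k : ℕ} (aU : Acyc k U)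
    (aV : Acyc k V) (hUV : U ∩ V = ∅) : Acyc k (U ∪ V) := by
  intro e he hbe
  obtain ⟨a, ha, b, hb, d, hd, h⟩ := small hU hV he (by rw [hbe]; exact Submodule.zero_mem _)
  have h1 : bd a = -bd b := by
    have := hbe
    rw [h, map_add, map_add, bd_bd, add_zero] at this
    exact eq_neg_of_add_eq_zero_left this
  have h2 : bd a = 0 := by
    refine SS_empty ?_
    rw [← hUV]
    refine SS_inter (bd_mem_SS ha) ?_
    rw [h1]
    exact Submodule.neg_mem _ (bd_mem_SS hb)
  obtain ⟨p, hp, hp'⟩ := aU a ha h2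
  obtain ⟨q, hq, hq'⟩ := aV b hb (by rw [h2] at h1; exact neg_eq_zero.1 h1.symm)
  refine ⟨p + q + d, Submodule.add_mem _ (Submodule.add_mem _ (SS_mono Set.subset_union_left hp)
    (SS_mono Set.subset_union_right hq)) hd, ?_⟩
  rw [map_add bd, map_add bd, hp', hq', h]

/-- inclusion of a subspace -/
def incl (W : Set X) : C(W, X) := ⟨Subtype.val, continuous_subtype_val⟩

theorem exists_incl {n : ℕ} {W : Set X} {c : Ch (Sg X) n} (hc : c ∈ SS W n) :
    ∃ c' : Ch (Sg W) n, push (incl W) c' = c := exists_push_val hc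

theorem incl_inj (W : Set X) : Function.Injective (incl W) := Subtype.val_injective

abbrev E2 := ℝ × ℝ

theorem vertex_apply (e i : Fin 2) :
    (stdSimplex.vertex e : Dl 1) i = if i = e then 1 else 0 := by
  change (Pi.single e (1 : ℝ) : Fin 2 → ℝ) i = _
  rw [Pi.single_apply]

theorem cont_coord (i : Fin 2) : Continuous fun t : Dl 1 => t.1 i :=
  (continuous_apply i).comp continuous_subtype_val

theorem acyc_star {W : Set E2} {y : E2} (hy : y ∈ W) (hW : StarConvex ℝ y W) (k : ℕ) :
    Acyc k W := by
  intro e he hbe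
  obtain ⟨c, rfl⟩ := exists_incl he
  have hc : bd c = 0 := push_injective (incl_inj W) (by rw [← bd_push, hbe, map_zero])
  let F : C(W × Dl 1, E2) := ⟨fun p => (p.2.1 0) • (p.1.1 : E2) + (p.2.1 1) • y,
    (((cont_coord 0).comp continuous_snd).smul (continuous_subtype_val.comp continuous_fst)).add
      (((cont_coord 1).comp continuous_snd).smul continuous_const)⟩
  have hF : ∀ p, F p ∈ W := by
    rintro ⟨x, t⟩
    change t.1 0 • (x.1 : E2) + t.1 1 • y ∈ W
    have h1 := stdSimplex.sum_eq_one t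
    rw [Fin.sum_univ_two] at h1
    rw [add_comm]
    exact hW x.2 (stdSimplex.zero_le t 1) (stdSimplex.zero_le t 0) (by rw [add_comm]; exact h1)
  have h0 : fend F 0 = incl W := by
    ext1 x
    change ((stdSimplex.vertex 0 : Dl 1) 0) • (x : E2) + ((stdSimplex.vertex 0 : Dl 1) 1) • y = x
    simp [vertex_apply]
  have h1 : fend F 1 = ContinuousMap.const W y := by
    ext1 x
    change ((stdSimplex.vertex 1 : Dl 1) 0) • (x : E2) + ((stdSimplex.vertex 1 : Dl 1) 1) • y = y
    simp [vertex_apply]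
  rw [← h0]
  refine homotopy_bounds F hF c hc ?_
  rw [h1]
  exact const_bounds y hy c hc

theorem acyc_punct (y : E2) (k : ℕ) : Acyc (k + 1) ({y}ᶜ : Set E2) := by
  have hcl1 : IsOpen {x : E2 | ¬ (x.2 = y.2 ∧ x.1 ≤ y.1)} := by
    have h : IsClosed {x : E2 | x.2 = y.2 ∧ x.1 ≤ y.1} :=
      (isClosed_eq continuous_snd continuous_const).inter
        (isClosed_le continuous_fst continuous_const)
    exact h.isOpen_compl
  have hcl2 : IsOpen {x : E2 | ¬ (x.2 = y.2 ∧ y.1 ≤ x.1)} := by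
    have h : IsClosed {x : E2 | x.2 = y.2 ∧ y.1 ≤ x.1} :=
      (isClosed_eq continuous_snd continuous_const).inter
        (isClosed_le continuous_const continuous_fst)
    exact h.isOpen_compl
  have hU : ({y}ᶜ : Set E2) = {x : E2 | ¬ (x.2 = y.2 ∧ x.1 ≤ y.1)} ∪
      {x : E2 | ¬ (x.2 = y.2 ∧ y.1 ≤ x.1)} := by
    ext x
    simp only [Set.mem_compl_iff, Set.mem_singleton_iff, Set.mem_union, Set.mem_ofPred_eq]
    rw [← not_and_or, not_iff_not, Prod.ext_iff]
    constructor
    · rintro ⟨h1, h2⟩; exact ⟨⟨h2, h1.le⟩, h2, h1.ge⟩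
    · rintro ⟨⟨h1, h2⟩, _, h3⟩; exact ⟨le_antisymm h2 h3, h1⟩
  rw [hU]
  refine acyc_union hcl1 hcl2 ?_ ?_ ?_
  · refine acyc_star (y := (y.1 + 1, y.2)) (by simp) ?_ _
    intro x hx a b ha hb hab
    simp only [Set.mem_ofPred_eq, Prod.snd_add, Prod.fst_add, Prod.smul_fst, Prod.smul_snd,
      smul_eq_mul] at hx ⊢
    rintro ⟨h1, h2⟩
    obtain rfl : a = 1 - b := by linarith
    have h3 : b * (x.2 - y.2) = 0 := by linarith
    rcases mul_eq_zero.1 h3 with h | h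
    · subst h; linarith
    · have : y.1 < x.1 := by
        by_contra hh
        exact hx ⟨by linarith, by linarith⟩
      rcases hb.lt_or_eq with hb | hb
      · nlinarith
      · subst hb; linarith
  · refine acyc_star (y := (y.1 - 1, y.2)) (by simp) ?_ _
    intro x hx a b ha hb hab
    simp only [Set.mem_ofPred_eq, Prod.snd_add, Prod.fst_add, Prod.smul_fst, Prod.smul_snd,
      smul_eq_mul] at hx ⊢
    rintro ⟨h1, h2⟩
    obtain rfl : a = 1 - b := by linarith
    have h3 : b * (x.2 - y.2) = 0 := by linarith
    rcases mul_eq_zero.1 h3 with h | h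
    · subst h; linarith
    · have : x.1 < y.1 := by
        by_contra hh
        exact hx ⟨by linarith, by linarith⟩
      rcases hb.lt_or_eq with hb | hb
      · nlinarith
      · subst hb; linarith
  · have : {x : E2 | ¬ (x.2 = y.2 ∧ x.1 ≤ y.1)} ∩ {x : E2 | ¬ (x.2 = y.2 ∧ y.1 ≤ x.1)} =
        {x : E2 | y.2 < x.2} ∪ {x : E2 | x.2 < y.2} := by
      ext x
      simp only [Set.mem_inter_iff, Set.mem_union, Set.mem_ofPred_eq]
      constructor
      · rintro ⟨h1, h2⟩
        rcases lt_trichotomy x.2 y.2 with h | h | h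
        · exact Or.inr h
        · exact absurd ⟨h, (not_le.1 fun h' => h1 ⟨h, h'⟩).le⟩ h2
        · exact Or.inl h
      · rintro (h | h)
        · exact ⟨fun h' => h.ne' h'.1, fun h' => h.ne' h'.1⟩
        · exact ⟨fun h' => h.ne h'.1, fun h' => h.ne h'.1⟩
    rw [this]
    refine acyc_disj (isOpen_lt continuous_const continuous_snd)
      (isOpen_lt continuous_snd continuous_const) ?_ ?_ ?_
    · refine acyc_star (y := (y.1, y.2 + 1)) (by simp) ?_ _
      refine Convex.starConvex ?_ (by simp)
      exact (convex_Ioi y.2).is_linear_preimage (f := fun x : E2 => x.2) ⟨fun _ _ => rfl, fun _ _ => rfl⟩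
    · refine acyc_star (y := (y.1, y.2 - 1)) (by simp) ?_ _
      refine Convex.starConvex ?_ (by simp)
      exact (convex_Iio y.2).is_linear_preimage (f := fun x : E2 => x.2) ⟨fun _ _ => rfl, fun _ _ => rfl⟩
    · ext x
      simp only [Set.mem_inter_iff, Set.mem_ofPred_eq, Set.mem_empty_iff_false, iff_false]
      rintro ⟨h1, h2⟩
      exact lt_asymm h1 h2

theorem radial {K : Set E2} (hK : IsCompact K) (hc : Convex ℝ K) {y : E2} (hy : y ∈ K) {k : ℕ}
    {e : Ch (Sg E2) (k + 1)} (he : e ∈ SS Kᶜ (k + 1)) (hbe : bd e = 0)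
    (hB : Bds ({y}ᶜ : Set E2) e) : Bds Kᶜ e := by
  obtain ⟨R, hR0, hR⟩ : ∃ R : ℝ, 0 < R ∧ ∀ x ∈ K, ‖x - y‖ ≤ R := by
    obtain ⟨R, hR⟩ := hK.isBounded.subset_closedBall y
    refine ⟨max R 1, by positivity, fun x hx => ?_⟩
    have := hR hx
    rw [Metric.mem_closedBall, dist_eq_norm] at this
    exact this.trans (le_max_left _ _)
  obtain ⟨f, hf, hfe⟩ := hB
  obtain ⟨f', rfl⟩ := exists_incl hf
  obtain ⟨c, rfl⟩ := exists_incl he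
  have hc0 : bd c = 0 := push_injective (incl_inj _) (by rw [← bd_push, hbe, map_zero])
  have hKy : Kᶜ ⊆ ({y}ᶜ : Set E2) := fun x hx h => hx (by rw [Set.mem_singleton_iff.1 h]; exact hy)
  have hne : ∀ x : ({y}ᶜ : Set E2), ‖x.1 - y‖ ≠ 0 := fun x h => x.2 (by
    rw [norm_eq_zero, sub_eq_zero] at h; exact h)
  have hneK : ∀ x : (Kᶜ : Set E2), ‖x.1 - y‖ ≠ 0 := fun x => hne ⟨x.1, hKy x.2⟩
  let j : C((Kᶜ : Set E2), ({y}ᶜ : Set E2)) := ⟨fun x => ⟨x.1, hKy x.2⟩, by fun_prop⟩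
  let r : C(({y}ᶜ : Set E2), E2) := ⟨fun x => y + (1 + R / ‖x.1 - y‖) • (x.1 - y), by
    refine continuous_const.add (Continuous.smul (continuous_const.add
      (Continuous.div continuous_const ?_ hne)) ?_) <;> fun_prop⟩
  let F : C((Kᶜ : Set E2) × Dl 1, E2) :=
    ⟨fun p => y + (1 + p.2.1 1 * (R / ‖p.1.1 - y‖)) • (p.1.1 - y), by
      refine continuous_const.add (Continuous.smul (continuous_const.add (Continuous.mul
        ((cont_coord 1).comp continuous_snd)
        (Continuous.div continuous_const ?_ fun p : (Kᶜ : Set E2) × Dl 1 => hneK p.1))) ?_) <;>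
      fun_prop⟩
  have hF : ∀ p, F p ∈ Kᶜ := by
    rintro ⟨x, t⟩ hx
    change y + (1 + t.1 1 * (R / ‖x.1 - y‖)) • (x.1 - y) ∈ K at hx
    have hs : 0 ≤ t.1 1 * (R / ‖x.1 - y‖) :=
      mul_nonneg (stdSimplex.zero_le t 1) (div_nonneg hR0.le (norm_nonneg _))
    generalize t.1 1 * (R / ‖x.1 - y‖) = s at hx hs
    apply x.2
    have h1 : (0 : ℝ) < 1 + s := by linarith
    have := hc hy hx (a := s / (1 + s)) (b := 1 / (1 + s)) (by positivity) (by positivity)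
      (by field_simp; ring)
    convert this using 1
    rw [smul_add, smul_smul, one_div_mul_cancel h1.ne', one_smul, ← add_assoc, ← add_smul,
      ← add_div, add_comm s 1, div_self h1.ne', one_smul]
    abel
  have h0 : fend F 0 = incl Kᶜ := by
    ext1 x
    change y + (1 + (stdSimplex.vertex 0 : Dl 1) 1 * (R / ‖x.1 - y‖)) • (x.1 - y) = x.1
    simp [vertex_apply]
  have h1 : fend F 1 = r.comp j := by
    ext1 x
    change y + (1 + (stdSimplex.vertex 1 : Dl 1) 1 * (R / ‖x.1 - y‖)) • (x.1 - y) =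
      y + (1 + R / ‖x.1 - y‖) • (x.1 - y)
    simp [vertex_apply]
  rw [← h0]
  refine homotopy_bounds F hF c hc0 ?_
  rw [h1, ← push_push]
  have h2 : bd f' = push j c := by
    refine push_injective (incl_inj _) ?_
    rw [← bd_push, hfe, push_push]
    rfl
  rw [← h2, ← bd_push]
  refine ⟨push r f', push_mem_SS' (W := Kᶜ) r (fun x => ?_) f', rfl⟩
  intro hx
  have h3 := hR _ hx
  change ‖y + (1 + R / ‖x.1 - y‖) • (x.1 - y) - y‖ ≤ R at h3
  have h4 : 0 < ‖x.1 - y‖ := lt_of_le_of_ne (norm_nonneg _) (hne x).symm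
  rw [add_sub_cancel_left, norm_smul, Real.norm_of_nonneg (by positivity), add_mul,
    div_mul_cancel₀ _ h4.ne'] at h3
  linarith

/-! ### charts -/

theorem exists_pull {φ : C(X, Y)} (hφ : Topology.IsOpenEmbedding φ) {W : Set X} {n : ℕ}
    {c : Ch (Sg Y) n} (hc : c ∈ SS (φ '' W) n) : ∃ c' ∈ SS W n, push φ c' = c := by
  have : (LinearMap.id : Ch (Sg Y) n →ₗ[ℤ] Ch (Sg Y) n) c ∈ (SS W n).map (push φ) := by
    refine SS_map _ (fun σ hσ => ?_) hc
    let h := hφ.isEmbedding.toHomeomorph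
    have hr : ∀ t, σ t ∈ Set.range φ := fun t => Set.image_subset_range _ _ (hσ t)
    let τ : Sg X n := ⟨fun t => h.symm ⟨σ t, hr t⟩, by fun_prop⟩
    have hτ : ∀ t, φ (τ t) = σ t := fun t => congrArg Subtype.val (h.apply_symm_apply ⟨σ t, hr t⟩)
    refine ⟨gen τ, gen_mem_SS fun t => ?_, ?_⟩
    · obtain ⟨w, hw, hw'⟩ := hσ t
      rw [← hτ] at hw'
      rwa [← hφ.injective hw']
    · rw [push_gen, LinearMap.id_apply]
      congr 1
      ext1 t
      exact hτ t
  obtain ⟨c', h1, h2⟩ := this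
  exact ⟨c', h1, h2⟩

/-- relative boundary -/
def BB {n : ℕ} (A : Set X) (c : Ch (Sg X) n) : Prop :=
  ∃ d : Ch (Sg X) (n + 1), c - bd d ∈ SS Aᶜ n

theorem key [T2Space X] {φ : C(E2, X)} (hφ : Topology.IsOpenEmbedding φ) {K : Set E2}
    (hK : IsCompact K) (hKc : Convex ℝ K) {y : E2} (hy : y ∈ K) {k : ℕ} {c : Ch (Sg X) (k + 2)}
    (hc : bd c ∈ SS (φ '' K)ᶜ (k + 1)) (h : 1 ≤ k ∨ BB {φ y} c) : BB (φ '' K) c := by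
  have hU : IsOpen (Set.range φ) := hφ.isOpen_range
  have hD : IsOpen (φ '' K)ᶜ := (hK.image φ.continuous).isClosed.isOpen_compl
  have hcov : Set.range φ ∪ (φ '' K)ᶜ = Set.univ := by
    rw [Set.eq_univ_iff_forall]
    intro x
    by_cases hx : x ∈ φ '' K
    · exact Or.inl (Set.image_subset_range _ _ hx)
    · exact Or.inr hx
  obtain ⟨a, ha, b, hb, d, -, hcd⟩ := small (c := c) hU hD (by rw [hcov]; exact SS_univ c)
    (Submodule.mem_sup_right hc)
  have hinter : ∀ W : Set E2, Set.range φ ∩ (φ '' W)ᶜ ⊆ φ '' Wᶜ := by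
    rintro W _ ⟨⟨x, rfl⟩, hx⟩
    exact ⟨x, fun h => hx ⟨x, h, rfl⟩, rfl⟩
  have hba : bd a ∈ SS (φ '' K)ᶜ (k + 1) := by
    have : bd a = bd c - bd b := by rw [hcd, map_add, map_add, bd_bd]; abel
    rw [this]
    exact Submodule.sub_mem _ hc (bd_mem_SS hb)
  have inj : ∀ n, Function.Injective (push (n := n) φ) := fun n => push_injective hφ.injective
  obtain ⟨e, he, hea⟩ := exists_pull hφ (SS_mono (hinter K) (SS_inter (bd_mem_SS ha) hba))
  have hbe : bd e = 0 := inj _ (by rw [← bd_push, hea, bd_bd, map_zero])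
  have hKy : Kᶜ ⊆ ({y}ᶜ : Set E2) := fun x hx h => hx (by rw [Set.mem_singleton_iff.1 h]; exact hy)
  have hB : Bds ({y}ᶜ : Set E2) e := by
    rcases h with h | h
    · obtain ⟨k, rfl⟩ := Nat.exists_eq_add_of_le' h
      exact acyc_punct y k e (SS_mono hKy he) hbe
    · obtain ⟨d1, hd1⟩ := h
      have hyK : (φ '' K)ᶜ ⊆ ({φ y}ᶜ : Set X) := fun x hx h =>
        hx (by rw [Set.mem_singleton_iff.1 h]; exact ⟨y, hy, rfl⟩)
      have hg : a - bd (d1 - d) ∈ SS ({φ y}ᶜ : Set X) (k + 2) := by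
        have : a - bd (d1 - d) = (c - bd d1) - b := by rw [hcd, map_sub bd]; abel
        rw [this]
        exact Submodule.sub_mem _ hd1 (SS_mono hyK hb)
      have hcov2 : Set.range φ ∪ ({φ y}ᶜ : Set X) = Set.univ :=
        Set.eq_univ_of_univ_subset (hcov ▸ Set.union_subset_union_right _ hyK)
      obtain ⟨a2, ha2, b2, hb2, q, -, hq⟩ := small (c := d1 - d) hU
        (isClosed_singleton (x := φ y)).isOpen_compl (by rw [hcov2]; exact SS_univ _) (by
          rw [← sub_sub_cancel a (bd (d1 - d))]
          exact Submodule.sub_mem _ (Submodule.mem_sup_left ha) (Submodule.mem_sup_right hg))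
      have h3 : a - bd a2 ∈ SS ({φ y}ᶜ : Set X) (k + 2) := by
        have : a - bd a2 = a - bd (d1 - d) + bd b2 := by
          rw [hq, map_add bd, map_add bd, bd_bd]; abel
        rw [this]
        exact Submodule.add_mem _ hg (bd_mem_SS hb2)
      rw [← Set.image_singleton] at h3
      obtain ⟨w, hw, hw'⟩ := exists_pull hφ (SS_mono (hinter {y})
        (SS_inter (Submodule.sub_mem _ ha (bd_mem_SS ha2)) h3))
      refine ⟨w, hw, inj _ ?_⟩
      rw [← bd_push, hw', hea, map_sub bd, bd_bd, sub_zero]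
  obtain ⟨f, hf, hfe⟩ := radial hK hKc hy he hbe hB
  rw [← Set.image_univ] at ha
  obtain ⟨a', -, ha'⟩ := exists_pull hφ ha
  have h5 : bd (a' - f) = 0 := by
    rw [map_sub bd, hfe, sub_eq_zero]
    exact inj _ (by rw [← bd_push, ha', hea])
  obtain ⟨g, -, hg⟩ := acyc_star (W := Set.univ) (y := y) trivial (starConvex_univ y) (k + 1)
    (a' - f) (SS_univ _) h5
  refine ⟨d + push φ g, ?_⟩
  have : c - bd (d + push φ g) = b + push φ f := by
    rw [map_add bd, bd_push, hg, map_sub (push φ), ha', hcd]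
    abel
  rw [this]
  refine Submodule.add_mem _ hb (push_mem_SS φ (fun x hx => ?_) hf)
  rintro ⟨z, hz, hz'⟩
  exact hx (hφ.injective hz' ▸ hz)

end
end NCS

namespace NCS
open Cvx

section
variable {X : Type} [TopologicalSpace X]

theorem BB.mono {n : ℕ} {A B : Set X} (h : A ⊆ B) {c : Ch (Sg X) n} (hc : BB B c) : BB A c := by
  obtain ⟨d, hd⟩ := hc
  exact ⟨d, SS_mono (Set.compl_subset_compl.2 h) hd⟩

/-- relative cycles in degree at least three, and relative 2-cycles which vanish
at each point, are relative boundaries -/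
def PP (A : Set X) : Prop := ∀ k : ℕ, ∀ c : Ch (Sg X) (k + 2), bd c ∈ SS Aᶜ (k + 1) →
  (1 ≤ k ∨ ∀ x ∈ A, BB {x} c) → BB A c

theorem PP_empty : PP (∅ : Set X) := fun k c _ _ =>
  ⟨0, by rw [Set.compl_empty]; exact SS_univ _⟩

theorem PP.union {A B : Set X} (cA : IsClosed A) (cB : IsClosed B) (hA : PP A) (hB : PP B)
    (hAB : PP (A ∩ B)) : PP (A ∪ B) := by
  intro k c hc h
  obtain ⟨d, hd⟩ := hA k c (SS_mono (Set.compl_subset_compl.2 Set.subset_union_left) hc)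
    (h.imp_right fun h x hx => h x (Or.inl hx))
  obtain ⟨d', hd'⟩ := hB k c (SS_mono (Set.compl_subset_compl.2 Set.subset_union_right) hc)
    (h.imp_right fun h x hx => h x (Or.inr hx))
  have e1 : bd (d - d') = (c - bd d') - (c - bd d) := by rw [map_sub bd]; abel
  have hsup : bd (d - d') ∈ SS Aᶜ (k + 2) ⊔ SS Bᶜ (k + 2) := by
    rw [e1]
    exact Submodule.sub_mem _ (Submodule.mem_sup_right hd') (Submodule.mem_sup_left hd)
  obtain ⟨w, hw⟩ := hAB (k + 1) (d - d') (by
    rw [e1]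
    exact Submodule.sub_mem _ (SS_mono (Set.compl_subset_compl.2 Set.inter_subset_right) hd')
      (SS_mono (Set.compl_subset_compl.2 Set.inter_subset_left) hd)) (Or.inl (by omega))
  rw [Set.compl_inter] at hw
  have e2 : bd (d - d' - bd w) = bd (d - d') := by rw [map_sub bd (d - d'), bd_bd, sub_zero]
  obtain ⟨a, ha, b, hb, r, -, hr⟩ := small cA.isOpen_compl cB.isOpen_compl hw
    (by rw [e2]; exact hsup)
  have e3 : bd (d - d') = bd a + bd b := by
    rw [← e2, hr, map_add, map_add, bd_bd, add_zero]
  refine ⟨d - a, ?_⟩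
  rw [Set.compl_union]
  refine SS_inter ?_ ?_
  · have : c - bd (d - a) = (c - bd d) + bd a := by rw [map_sub bd]; abel
    rw [this]
    exact Submodule.add_mem _ hd (bd_mem_SS ha)
  · have : c - bd (d - a) = (c - bd d') - bd b := by
      have h4 : bd a = bd d - bd d' - bd b := by
        rw [map_sub bd] at e3
        rw [e3]; abel
      rw [map_sub bd, h4]; abel
    rw [this]
    exact Submodule.sub_mem _ hd' (bd_mem_SS hb)

theorem PP_finite [T2Space X] {φ : C(E2, X)} (hφ : Topology.IsOpenEmbedding φ) (s : Finset E2) :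
    ∀ K : E2 → Set E2, (∀ i, IsCompact (K i) ∧ Convex ℝ (K i)) → PP (φ '' ⋃ i ∈ s, K i) := by
  classical
  induction s using Finset.induction_on with
  | empty => intro K _; simpa using PP_empty
  | insert a s _ ih =>
    intro K hK
    rw [Finset.set_biUnion_insert, Set.image_union]
    have hc : ∀ L : Set E2, IsCompact L → IsClosed (φ '' L) :=
      fun L hL => (hL.image φ.continuous).isClosed
    refine PP.union (hc _ (hK a).1) (hc _ (s.isCompact_biUnion fun i _ => (hK i).1)) ?_ (ih K hK) ?_
    · intro k c hcc h
      rcases (K a).eq_empty_or_nonempty with h0 | ⟨y, hy⟩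
      · rw [h0, Set.image_empty]; exact PP_empty k c (by simpa using SS_univ _) (h.imp_right (by simp))
      · exact key hφ (hK a).1 (hK a).2 hy hcc (h.imp_right fun h => h _ ⟨y, hy, rfl⟩)
    · rw [← Set.image_inter hφ.injective, Set.inter_iUnion₂]
      exact ih (fun i => K a ∩ K i) fun i => ⟨(hK a).1.inter (hK i).1, (hK a).2.inter (hK i).2⟩

theorem PP_chart [T2Space X] {φ : C(E2, X)} (hφ : Topology.IsOpenEmbedding φ) {B : Set E2}
    (hB : IsCompact B) : PP (φ '' B) := by
  intro k c hc h
  have hO : IsOpen (φ ⁻¹' (img (bd c))ᶜ) :=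
    (isCompact_img (bd c)).isClosed.isOpen_compl.preimage φ.continuous
  have hBO : B ⊆ φ ⁻¹' (img (bd c))ᶜ := by
    intro x hx hx'
    exact mem_SS_iff.1 hc hx' ⟨x, hx, rfl⟩
  have : ∀ x : E2, ∃ ε : ℝ, 0 < ε ∧ (x ∈ B → Metric.closedBall x ε ⊆ φ ⁻¹' (img (bd c))ᶜ) := by
    intro x
    by_cases hx : x ∈ B
    · obtain ⟨ε, h1, h2⟩ := Metric.nhds_basis_closedBall.mem_iff.1 (hO.mem_nhds (hBO hx))
      exact ⟨ε, h1, fun _ => h2⟩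
    · exact ⟨1, one_pos, fun h => absurd h hx⟩
  choose ε hε0 hε using this
  obtain ⟨t, ht, htB⟩ := hB.elim_nhds_subcover (fun x => Metric.closedBall x (ε x))
    fun x _ => Metric.closedBall_mem_nhds x (hε0 x)
  have hdisj : ∀ x ∈ B, bd c ∈ SS (φ '' Metric.closedBall x (ε x))ᶜ (k + 1) := by
    intro x hx
    rw [mem_SS_iff]
    rintro z hz ⟨w, hw, rfl⟩
    exact hε x hx hw hz
  refine BB.mono (Set.image_mono htB) (PP_finite hφ t (fun x => Metric.closedBall x (ε x))
    (fun x => ⟨isCompact_closedBall _ _, convex_closedBall _ _⟩) k c ?_ ?_)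
  · rw [mem_SS_iff]
    rintro z hz ⟨w, hw, rfl⟩
    obtain ⟨x, hx, hw⟩ := Set.mem_iUnion₂.1 hw
    exact hε x (ht x hx) hw hz
  · refine h.imp_right fun h => ?_
    rintro _ ⟨w, hw, rfl⟩
    obtain ⟨x, hx, hw⟩ := Set.mem_iUnion₂.1 hw
    refine BB.mono (Set.singleton_subset_iff.2 (Set.mem_image_of_mem φ hw))
      (key hφ (isCompact_closedBall x (ε x)) (convex_closedBall _ _)
        (Metric.mem_closedBall_self (hε0 x).le) (hdisj x (ht x hx))
        (Or.inr (h _ ⟨x, ht x hx, rfl⟩)))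

/-- surfaces -/
def Surf (X : Type) [TopologicalSpace X] : Prop :=
  ∀ x : X, ∃ φ : C(E2, X), Topology.IsOpenEmbedding φ ∧ x ∈ Set.range φ

theorem Surf.nhd (hX : Surf X) (x : X) : ∃ (φ : C(E2, X)) (y : E2), Topology.IsOpenEmbedding φ ∧
    φ y = x ∧ φ '' Metric.closedBall y 1 ∈ nhds x := by
  obtain ⟨φ, hφ, y, rfl⟩ := hX x
  exact ⟨φ, y, hφ, rfl, hφ.isOpenMap.image_mem_nhds (Metric.closedBall_mem_nhds y one_pos)⟩

theorem PP_compact [T2Space X] (hX : Surf X) {B : Set X} (hB : IsCompact B) : PP B := by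
  suffices h : ∀ C : Set X, IsCompact C → C ⊆ closure B → PP C from h B hB subset_closure
  refine hB.induction_on (p := fun A => ∀ C : Set X, IsCompact C → C ⊆ closure A → PP C)
    ?_ ?_ ?_ ?_
  · intro C _ hC
    rw [closure_empty, Set.subset_empty_iff] at hC
    rw [hC]; exact PP_empty
  · intro s t hst ht C hC hCs
    exact ht C hC (hCs.trans (closure_mono hst))
  · intro s t hs ht C hC hCst
    rw [closure_union] at hCst
    have : C = (C ∩ closure s) ∪ (C ∩ closure t) := by
      rw [← Set.inter_union_distrib_left, Set.inter_eq_left.2 hCst]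
    have c1 : IsCompact (C ∩ closure s) := hC.inter_right isClosed_closure
    have c2 : IsCompact (C ∩ closure t) := hC.inter_right isClosed_closure
    rw [this]
    exact PP.union c1.isClosed c2.isClosed (hs _ c1 Set.inter_subset_right)
      (ht _ c2 Set.inter_subset_right)
      (hs _ (c1.inter c2) (Set.inter_subset_left.trans Set.inter_subset_right))
  · intro x _
    obtain ⟨φ, y, hφ, -, hn⟩ := hX.nhd x
    refine ⟨_, mem_nhdsWithin_of_mem_nhds hn, fun C hC hCs => ?_⟩
    have hK := isCompact_closedBall y 1
    rw [(hK.image φ.continuous).isClosed.closure_eq] at hCs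
    have h1 : C = φ '' (φ ⁻¹' C) := by
      rw [Set.image_preimage_eq_inter_range, Set.inter_eq_left.2]
      exact hCs.trans (Set.image_subset_range _ _)
    rw [h1]
    refine PP_chart hφ (hK.of_isClosed_subset (hC.isClosed.preimage φ.continuous) ?_)
    intro w hw
    obtain ⟨v, hv, hv'⟩ := hCs hw
    exact hφ.injective hv' ▸ hv

theorem BB_all [T2Space X] [ConnectedSpace X] (hX : Surf X) (hnc : ¬ CompactSpace X)
    {z : Ch (Sg X) 2} (hz : bd z = 0) (x : X) : BB {x} z := by
  have loc : ∀ x : X, ∃ t ∈ nhds x, ∀ u ∈ t, (BB {u} z ↔ BB {x} z) := by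
    intro x
    obtain ⟨φ, y, hφ, rfl, hn⟩ := hX.nhd x
    refine ⟨_, hn, ?_⟩
    have : ∀ v ∈ Metric.closedBall y 1, ∀ w ∈ Metric.closedBall y 1, BB {φ v} z → BB {φ w} z := by
      intro v hv w hw h
      refine BB.mono (Set.singleton_subset_iff.2 (Set.mem_image_of_mem φ hw))
        (key (k := 0) hφ (isCompact_closedBall y 1) (convex_closedBall _ _) hv ?_ (Or.inr h))
      rw [hz]; exact Submodule.zero_mem _
    have hy : y ∈ Metric.closedBall y 1 := Metric.mem_closedBall_self zero_le_one
    rintro _ ⟨v, hv, rfl⟩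
    exact ⟨this v hv y hy, this y hy v hv⟩
  have hcl : IsClopen {x : X | BB {x} z} := by
    constructor
    · rw [← isOpen_compl_iff, isOpen_iff_mem_nhds]
      intro x hx
      obtain ⟨t, ht, h⟩ := loc x
      exact Filter.mem_of_superset ht fun u hu hu' => hx ((h u hu).1 hu')
    · rw [isOpen_iff_mem_nhds]
      intro x hx
      obtain ⟨t, ht, h⟩ := loc x
      exact Filter.mem_of_superset ht fun u hu => (h u hu).2 hx
  have hne : ∃ x, x ∉ img z := by
    by_contra! h
    exact hnc ⟨(Set.eq_univ_iff_forall.2 h) ▸ isCompact_img z⟩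
  obtain ⟨x0, hx0⟩ := hne
  have : x0 ∈ {x : X | BB {x} z} := by
    refine ⟨0, ?_⟩
    rw [map_zero, sub_zero, mem_SS_iff]
    rintro u hu rfl
    exact hx0 hu
  have h := hcl.eq_univ ⟨x0, this⟩
  exact (h ▸ Set.mem_univ x : x ∈ {x : X | BB {x} z})

theorem main [T2Space X] [ConnectedSpace X] (hX : Surf X) (hnc : ¬ CompactSpace X) {k : ℕ}
    {z : Ch (Sg X) (k + 2)} (hz : bd z = 0) : ∃ s, bd s = z := by
  have hall : 1 ≤ k ∨ ∀ x : X, BB {x} z := by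
    rcases Nat.eq_zero_or_pos k with rfl | h
    · exact Or.inr fun x => BB_all hX hnc hz x
    · exact Or.inl h
  have : WeaklyLocallyCompactSpace X := ⟨fun x => by
    obtain ⟨φ, y, hφ, -, hn⟩ := hX.nhd x
    exact ⟨_, (isCompact_closedBall y 1).image φ.continuous, hn⟩⟩
  obtain ⟨U, hU, hzU, hUc⟩ := exists_isOpen_superset_and_isCompact_closure (isCompact_img z)
  have hzU := mem_SS_iff.2 hzU
  obtain ⟨d, hd⟩ := PP_compact hX hUc k z (by rw [hz]; exact Submodule.zero_mem _)
    (hall.imp_right fun h x _ => h x)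
  have hfr : (frontier U)ᶜ = U ∪ (closure U)ᶜ := by
    rw [hU.frontier_eq, Set.sdiff_eq, Set.compl_inter, compl_compl, Set.union_comm]
  have e1 : bd d = z - (z - bd d) := by abel
  have hsup : bd d ∈ SS U (k + 2) ⊔ SS (closure U)ᶜ (k + 2) := by
    rw [e1]
    exact Submodule.sub_mem _ (Submodule.mem_sup_left hzU) (Submodule.mem_sup_right hd)
  obtain ⟨w, hw⟩ := PP_compact hX (hUc.of_isClosed_subset isClosed_frontier frontier_subset_closure)
    (k + 1) d (by
      rw [hfr, e1]
      exact Submodule.sub_mem _ (SS_mono Set.subset_union_left hzU)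
        (SS_mono Set.subset_union_right hd)) (Or.inl (by omega))
  rw [hfr] at hw
  have e2 : bd (d - bd w) = bd d := by rw [map_sub bd d, bd_bd, sub_zero]
  obtain ⟨a, ha, b, hb, r, -, hr⟩ := small hU isClosed_closure.isOpen_compl hw
    (by rw [e2]; exact hsup)
  have e3 : bd d = bd a + bd b := by
    rw [← e2, hr, map_add, map_add, bd_bd, add_zero]
  refine ⟨a, ?_⟩
  have h0 : z - bd a = 0 := by
    refine SS_empty (SS_mono (U := U ∩ (closure U)ᶜ) ?_ (SS_inter ?_ ?_))
    · rintro x ⟨h1, h2⟩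
      exact h2 (subset_closure h1)
    · exact Submodule.sub_mem _ hzU (bd_mem_SS ha)
    · have : z - bd a = (z - bd d) + bd b := by rw [e3]; abel
      rw [this]
      exact Submodule.add_mem _ hd (bd_mem_SS hb)
  exact (sub_eq_zero.1 h0).symm

theorem surf_of_loc (h : ∀ x : X, ∃ U : Set X, IsOpen U ∧ x ∈ U ∧ Nonempty (U ≃ₜ (ℝ × ℝ))) :
    Surf X := by
  intro x
  obtain ⟨U, hU, hx, ⟨e⟩⟩ := h x
  refine ⟨⟨fun p => (e.symm p).1, by fun_prop⟩,
    hU.isOpenEmbedding_subtypeVal.comp e.symm.isOpenEmbedding, e ⟨x, hx⟩, ?_⟩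
  change (e.symm (e ⟨x, hx⟩)).1 = x
  rw [e.symm_apply_apply]

end
end NCS

namespace NCS

/-! ### comparison with the categorical definition -/
section
variable {X : Type} [TopologicalSpace X]

/-- singular simplices -/
abbrev Sing (X : Type) [TopologicalSpace X] (n : ℕ) : Type :=
  (TopCat.toSSet.obj (TopCat.of X)).obj (Opposite.op (SimplexCategory.mk n))

/-- simplices as continuous maps -/
noncomputable def sE (n : ℕ) : Sing X n ≃ Sg X n := TopCat.toSSetObjEquiv (TopCat.of X) _

theorem sE_δ {n : ℕ} (i : Fin (n + 2)) (σ : Sing X (n + 1)) :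
    sE n ((TopCat.toSSet.obj (TopCat.of X)).δ i σ) = HasFace.face i (sE (n + 1) σ) := rfl

/-- comparison of chain groups -/
noncomputable def qE (n : ℕ) : FreeAbelianGroup (Sing X n) ≃+ Ch (Sg X) n :=
  (FreeAbelianGroup.equivFinsupp _).trans (Finsupp.domCongr (sE n))

theorem qE_of {n : ℕ} (σ : Sing X n) : qE n (FreeAbelianGroup.of σ) = gen (sE n σ) := by
  simp [qE]

/-- the differential -/
noncomputable def dd (n : ℕ) : FreeAbelianGroup (Sing X (n + 1)) →+ FreeAbelianGroup (Sing X n) :=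
  ((singularChainComplex (TopCat.of X)).d (n + 1) n).hom

theorem dd_of {n : ℕ} (σ : Sing X (n + 1)) : dd n (FreeAbelianGroup.of σ) =
    ∑ i : Fin (n + 2), (-1 : ℤ) ^ (i : ℕ) •
      FreeAbelianGroup.of ((TopCat.toSSet.obj (TopCat.of X)).δ i σ) := by
  have h : (singularChainComplex (TopCat.of X)).d (n + 1) n =
    ∑ i : Fin (n + 2), (-1 : ℤ) ^ (i : ℕ) • (((SimplicialObject.whiskering (Type)
      AddCommGrpCat).obj AddCommGrpCat.free).obj (TopCat.toSSet.obj (TopCat.of X))).δ i :=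
    AlgebraicTopology.AlternatingFaceMapComplex.obj_d_eq _ _
  let L := AddCommGrpCat.homAddEquiv
    (M := (singularChainComplex (TopCat.of X)).X (n + 1))
    (N := (singularChainComplex (TopCat.of X)).X n)
  have h2 : dd (X := X) n = ∑ i : Fin (n + 2), (-1 : ℤ) ^ (i : ℕ) •
      FreeAbelianGroup.map ((TopCat.toSSet.obj (TopCat.of X)).δ i) := by
    change L ((singularChainComplex (TopCat.of X)).d (n + 1) n) = _
    rw [h]
    refine (map_sum L _ _).trans (Finset.sum_congr rfl fun i _ => ?_)
    exact map_zsmul L _ _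
  rw [h2, AddMonoidHom.finsetSum_apply]
  refine Finset.sum_congr rfl fun i _ => ?_
  rw [AddMonoidHom.smul_apply]
  congr 1

theorem qE_dd {n : ℕ} (x : FreeAbelianGroup (Sing X (n + 1))) :
    qE n (dd n x) = bd (qE (n + 1) x) := by
  have : ((qE n).toAddMonoidHom.comp (dd n) : FreeAbelianGroup (Sing X (n + 1)) →+ Ch (Sg X) n) =
      (bd (A := Sg X)).toAddMonoidHom.comp (qE (n + 1)).toAddMonoidHom := by
    refine FreeAbelianGroup.lift_ext _ _ fun σ => ?_
    change qE n (dd n _) = bd (qE (n + 1) _)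
    rw [dd_of, qE_of, bd_gen, map_sum]
    refine Finset.sum_congr rfl fun i _ => ?_
    rw [map_zsmul, qE_of, sE_δ]
  exact DFunLike.congr_fun this x

theorem isZero_of_exact {k : ℕ}
    (h : ∀ z : Ch (Sg X) (k + 2), bd z = 0 → ∃ s, bd s = z) :
    Limits.IsZero (singularHomology (TopCat.of X) (k + 2)) := by
  rw [singularHomology, ← HomologicalComplex.exactAt_iff_isZero_homology,
    HomologicalComplex.exactAt_iff' _ (k + 3) (k + 2) (k + 1) (by simp) (by simp),
    ShortComplex.ab_exact_iff]
  intro x hx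
  obtain ⟨y, rfl⟩ : ∃ y : FreeAbelianGroup (Sing X (k + 2)), y = x := ⟨x, rfl⟩
  replace hx : dd (X := X) (k + 1) y = 0 := hx
  have h1 : bd (qE (X := X) (k + 2) y) = 0 := by rw [← qE_dd, hx, map_zero]
  obtain ⟨s, hs⟩ := h _ h1
  refine ⟨(qE (X := X) (k + 3)).symm s, ?_⟩
  change dd (X := X) (k + 2) ((qE (X := X) (k + 3)).symm s) = y
  apply (qE (X := X) (k + 2)).injective
  rw [qE_dd, AddEquiv.apply_symm_apply, hs]

end
end NCS

/-- a connected, non-compact surface `M` (a Hausdorff, second-countable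
space, locally homeomorphic to `ℝ²`) has `H_j(M; ℤ) = 0` for all `j ≥ 2`. -/
theorem stmt2 (M : Type) [TopologicalSpace M] [T2Space M] [SecondCountableTopology M]
    (hloc : ∀ x : M, ∃ U : Set M, IsOpen U ∧ x ∈ U ∧ Nonempty (U ≃ₜ (ℝ × ℝ)))
    [ConnectedSpace M] (hnc : ¬ CompactSpace M) :
    ∀ j : ℕ, 2 ≤ j → Limits.IsZero (singularHomology (TopCat.of M) j) := by
  intro j hj
  obtain ⟨k, rfl⟩ := Nat.exists_eq_add_of_le' hj
  exact NCS.isZero_of_exact fun z hz => NCS.main (NCS.surf_of_loc hloc) hnc hz
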